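/- arXiv:2509.19148 — 10 statements merged into one kernel-verified Lean document; each statement's English description precedes it below -/
import Mathlib

section
/- Let (A,B) be an inclusion of C*-algebras and let n ∈ N(A,B) be a normalizer. Then the closure of nBn* = {n b n* : b ∈ B} is a hereditary C*-subalgebra of B (i.e., whenever a ∈ B, c lies in this closure and 0 ≤ a ≤ c, then a lies in the closure), and the closure of nBn* equals the closure of |n*| B |n*|, where |n*| = (n n*)^{1/2}. -/
section Defs

variable {A : Type*} [NonUnitalCStarAlgebra A] [PartialOrder A] [StarOrderedRing A]

/-- `n` is a normalizer of `B` in `A`: `n B n* ⊆ B` and `n* B n ⊆ B`. -/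
def IsNormalizer (B : Set A) (n : A) : Prop :=
  (∀ b ∈ B, n * b * star n ∈ B) ∧ (∀ b ∈ B, star n * b * n ∈ B)

/-- `(A, B)` is an inclusion of C*-algebras: `B` is a closed *-subalgebra of `A`
containing an approximate unit for `A`. -/
structure IsInclusion (B : Set A) : Prop where
  zero_mem : (0 : A) ∈ B
  add_mem : ∀ x ∈ B, ∀ y ∈ B, x + y ∈ B
  smul_mem : ∀ (c : ℂ), ∀ x ∈ B, c • x ∈ B
  mul_mem : ∀ x ∈ B, ∀ y ∈ B, x * y ∈ B
  star_mem : ∀ x ∈ B, star x ∈ B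
  isClosed : IsClosed B
  approxUnit : ∀ (s : Finset A), ∀ ε : ℝ, 0 < ε →
    ∃ e ∈ B, 0 ≤ e ∧ ‖e‖ ≤ 1 ∧ ∀ a ∈ s, ‖e * a - a‖ < ε

/-- A regular inclusion: an inclusion whose normalizers span a dense subspace of `A`. -/
def IsRegularInclusion (B : Set A) : Prop :=
  IsInclusion B ∧ Dense (↑(Submodule.span ℂ {n : A | IsNormalizer B n}) : Set A)

/-- `J` is a closed two-sided ideal of the C*-subalgebra `C`. -/
structure IsClosedIdealOf (C J : Set A) : Prop where
  subset : J ⊆ C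
  zero_mem : (0 : A) ∈ J
  add_mem : ∀ x ∈ J, ∀ y ∈ J, x + y ∈ J
  smul_mem : ∀ (c : ℂ), ∀ x ∈ J, c • x ∈ J
  mul_left : ∀ c ∈ C, ∀ x ∈ J, c * x ∈ J
  mul_right : ∀ x ∈ J, ∀ c ∈ C, x * c ∈ J
  isClosed : IsClosed J

/-- The annihilator `X^{⊥}` of `X`, computed inside `C`. -/
def Ann (C X : Set A) : Set A :=
  {c ∈ C | ∀ x ∈ X, c * x = 0 ∧ x * c = 0}

/-- `J` is a regular ideal of `C`: a closed two-sided ideal with `J = J^{⊥⊥}` in `C`. -/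
def IsRegularIdealOf (C J : Set A) : Prop :=
  IsClosedIdealOf C J ∧ Ann C (Ann C J) = J

/-- The inclusion `(C, B)` has the ideal intersection property: every nonzero closed
two-sided ideal of `C` meets `B` nontrivially. -/
def IdealIntersectionProperty (C B : Set A) : Prop :=
  ∀ J : Set A, IsClosedIdealOf C J → (∃ x ∈ J, x ≠ 0) → ∃ x ∈ J ∩ B, x ≠ 0

/-- The relative commutant of `D` in `A`. -/
def RelComm (D : Set A) : Set A := {a : A | ∀ d ∈ D, a * d = d * a}

/-- `(A, D)` is a pseudo-Cartan inclusion. -/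
structure IsPseudoCartan (D : Set A) : Prop where
  inclusion : IsInclusion D
  regular : Dense (↑(Submodule.span ℂ {n : A | IsNormalizer D n}) : Set A)
  abelian : ∀ x ∈ D, ∀ y ∈ D, x * y = y * x
  relCommAbelian : ∀ x ∈ RelComm D, ∀ y ∈ RelComm D, x * y = y * x
  iip_relComm : IdealIntersectionProperty (RelComm D) D
  iip_A : IdealIntersectionProperty (Set.univ : Set A) (RelComm D)

/-- `K` is an invariant ideal of `D`: `n K n* ⊆ K` for every normalizer `n`. -/
def IsInvariantIdeal (D K : Set A) : Prop :=
  ∀ n : A, IsNormalizer D n → ∀ x ∈ K, n * x * star n ∈ K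

/-- `K` is an invariant regular ideal of `D`. -/
def IsInvariantRegularIdeal (D K : Set A) : Prop :=
  IsRegularIdealOf D K ∧ IsInvariantIdeal D K

/-- The image set `x B y = {x * b * y : b ∈ B}`. -/
def twoSidedImage (x y : A) (B : Set A) : Set A := (fun b => x * b * y) '' B

end Defs

section Helpers

open Filter Topology

variable {A : Type*} [NonUnitalCStarAlgebra A] [PartialOrder A] [StarOrderedRing A]

/-- `B` as a bundled star subalgebra. -/
def IsInclusion.toSub {B : Set A} (hB : IsInclusion B) : NonUnitalStarSubalgebra ℂ A where
  carrier := B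
  zero_mem' := hB.zero_mem
  add_mem' := fun {x y} hx hy => hB.add_mem x hx y hy
  smul_mem' := fun c x hx => hB.smul_mem c x hx
  mul_mem' := fun {x y} hx hy => hB.mul_mem x hx y hy
  star_mem' := fun {x} hx => hB.star_mem x hx

lemma IsInclusion.cfc_mem {B : Set A} (hB : IsInclusion B) (f : ℝ → ℝ) {a : A} (ha : a ∈ B) :
    cfcₙ f a ∈ B := by
  have hs : IsClosed (hB.toSub : Set A) := hB.isClosed
  exact cfcₙ_mem (𝕜' := ℂ) (s := hB.toSub) f ha

lemma exists_v {B : Set A} (hB : IsInclusion B) {h : A} (hh : 0 ≤ h) (hhB : h ∈ B)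
    (d : ℝ) (hd : 0 < d) : ∃ v ∈ B, star (h * v) = h * v ∧ h * v = v * h ∧ ‖h * v‖ ≤ 1 ∧
      ‖h * v * h - h‖ ≤ d := by
  have hsa : IsSelfAdjoint h := IsSelfAdjoint.of_nonneg hh
  have hpos : ∀ t : ℝ, 0 < t ^ 2 + d ^ 2 := fun t => by positivity
  have hc : Continuous (fun t : ℝ => t / (t ^ 2 + d ^ 2)) :=
    continuous_id.div (by fun_prop) (fun t => (hpos t).ne')
  have hc0 : (fun t : ℝ => t / (t ^ 2 + d ^ 2)) 0 = 0 := by simp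
  have hid : cfcₙ (fun t : ℝ => t) h = h := cfcₙ_id' ℝ h
  have e1 : cfcₙ (fun t : ℝ => t * (t / (t ^ 2 + d ^ 2))) h
      = h * cfcₙ (fun t : ℝ => t / (t ^ 2 + d ^ 2)) h := by
    rw [cfcₙ_mul (fun t : ℝ => t) _ h continuousOn_id rfl hc.continuousOn hc0, hid]
  have e2 : cfcₙ (fun t : ℝ => t * (t / (t ^ 2 + d ^ 2))) h
      = cfcₙ (fun t : ℝ => t / (t ^ 2 + d ^ 2)) h * h := by
    have : (fun t : ℝ => t * (t / (t ^ 2 + d ^ 2))) = fun t => (t / (t ^ 2 + d ^ 2)) * t := by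
      funext t; ring
    rw [this, cfcₙ_mul _ (fun t : ℝ => t) h hc.continuousOn hc0 continuousOn_id rfl, hid]
  have hc2 : Continuous (fun t : ℝ => t * (t / (t ^ 2 + d ^ 2))) := continuous_id.mul hc
  have e3 : cfcₙ (fun t : ℝ => t * (t / (t ^ 2 + d ^ 2)) * t - t) h
      = h * cfcₙ (fun t : ℝ => t / (t ^ 2 + d ^ 2)) h * h - h := by
    rw [cfcₙ_sub (fun t : ℝ => t * (t / (t ^ 2 + d ^ 2)) * t) (fun t : ℝ => t) h (hc2.mul continuous_id).continuousOn (by simp)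
      continuousOn_id rfl,
      cfcₙ_mul _ (fun t : ℝ => t) h hc2.continuousOn (by simp) continuousOn_id rfl, hid, e1]
  refine ⟨cfcₙ (fun t : ℝ => t / (t ^ 2 + d ^ 2)) h, hB.cfc_mem _ hhB, ?_, ?_, ?_, ?_⟩
  · rw [← e1]; exact (cfcₙ_predicate (R := ℝ) _ h : IsSelfAdjoint _).star_eq
  · rw [← e1, e2]
  · rw [← e1]
    refine norm_cfcₙ_le fun t _ => ?_
    have : t * (t / (t ^ 2 + d ^ 2)) = t ^ 2 / (t ^ 2 + d ^ 2) := by ring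
    rw [this, Real.norm_of_nonneg (by positivity), div_le_one (hpos t)]
    nlinarith [sq_nonneg d]
  · rw [← e3]
    refine norm_cfcₙ_le fun t _ => ?_
    have : t * (t / (t ^ 2 + d ^ 2)) * t - t = - (t * d ^ 2 / (t ^ 2 + d ^ 2)) := by
      have := (hpos t).ne'
      field_simp; ring
    rw [this, norm_neg, norm_div, Real.norm_of_nonneg (hpos t).le, div_le_iff₀ (hpos t),
      Real.norm_eq_abs, abs_mul, abs_of_nonneg (sq_nonneg d), ← sq_abs t]
    nlinarith [sq_nonneg (|t| - d), abs_nonneg t, mul_nonneg hd.le (sq_nonneg (|t| - d)),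
      mul_nonneg (mul_nonneg hd.le hd.le) (abs_nonneg t), pow_pos hd 3,
      mul_nonneg hd.le (sq_nonneg (|t|))]

lemma norm_sq_u {u x : A} (hu : star u = u) (hu1 : ‖u‖ ≤ 1) :
    ‖u * x - x‖ ^ 2 ≤ 2 * ‖u * (x * star x) - x * star x‖ := by
  have e : (u * x - x) * star (u * x - x) =
      (u * (x * star x) - x * star x) * u - (u * (x * star x) - x * star x) := by
    rw [star_sub, star_mul, hu]; noncomm_ring
  rw [pow_two, ← CStarRing.norm_self_mul_star, e]
  calc _ ≤ ‖(u * (x * star x) - x * star x) * u‖ + ‖u * (x * star x) - x * star x‖ :=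
        norm_sub_le _ _
    _ ≤ ‖u * (x * star x) - x * star x‖ * ‖u‖ + ‖u * (x * star x) - x * star x‖ := by
        gcongr; exact norm_mul_le _ _
    _ ≤ _ := by nlinarith [norm_nonneg (u * (x * star x) - x * star x)]

lemma tendsto_of_sq {f : ℕ → ℝ} (hf0 : ∀ k, 0 ≤ f k)
    (h : Tendsto (fun k => f k ^ 2) atTop (𝓝 0)) : Tendsto f atTop (𝓝 0) := by
  have := (Real.continuous_sqrt.tendsto 0).comp h
  rw [Real.sqrt_zero] at this
  exact this.congr fun k => Real.sqrt_sq (hf0 k)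

lemma tendsto_u {u : ℕ → A} (hu : ∀ k, star (u k) = u k) (hu1 : ∀ k, ‖u k‖ ≤ 1) {x : A}
    (h : Tendsto (fun k => u k * (x * star x)) atTop (𝓝 (x * star x))) :
    Tendsto (fun k => u k * x) atTop (𝓝 x) := by
  rw [tendsto_iff_norm_sub_tendsto_zero] at h ⊢
  refine tendsto_of_sq (fun k => norm_nonneg _) ?_
  refine squeeze_zero (fun k => sq_nonneg _) (fun k => norm_sq_u (hu k) (hu1 k)) ?_
  simpa using h.const_mul 2

/-- The approximate unit built from `h`. -/
lemma exists_seq {B : Set A} (hB : IsInclusion B) {h : A} (hh : 0 ≤ h) (hhB : h ∈ B) :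
    ∃ u : ℕ → A, (∀ k, star (u k) = u k) ∧ (∀ k, ‖u k‖ ≤ 1) ∧
      (∀ k, ∃ v ∈ B, u k = h * v ∧ u k = v * h) ∧
      Tendsto (fun k => u k * h) atTop (𝓝 h) := by
  choose v hv h1 h2 h3 h4 using fun k : ℕ =>
    exists_v hB hh hhB (1 / ((k : ℝ) + 1)) (by positivity)
  refine ⟨fun k => h * v k, h1, h3, fun k => ⟨v k, hv k, rfl, h2 k⟩, ?_⟩
  rw [tendsto_iff_norm_sub_tendsto_zero]
  exact squeeze_zero (fun k => norm_nonneg _) h4 tendsto_one_div_add_atTop_nhds_zero_nat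

lemma tendsto_closure {u : ℕ → A} (hu1 : ∀ k, ‖u k‖ ≤ 1) {S : Set A}
    (hS : ∀ x ∈ S, Tendsto (fun k => u k * x) atTop (𝓝 x)) {c : A} (hc : c ∈ closure S) :
    Tendsto (fun k => u k * c) atTop (𝓝 c) := by
  rw [Metric.tendsto_atTop]
  intro ε hε
  obtain ⟨x, hx, hxc⟩ := Metric.mem_closure_iff.1 hc (ε / 3) (by positivity)
  obtain ⟨N, hN⟩ := Metric.tendsto_atTop.1 (hS x hx) (ε / 3) (by positivity)
  refine ⟨N, fun k hk => ?_⟩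
  have h1 := hN k hk
  rw [dist_eq_norm] at *
  have e : u k * c - c = u k * (c - x) + (u k * x - x) - (c - x) := by noncomm_ring
  have h2 : ‖u k * (c - x)‖ ≤ ‖c - x‖ := (norm_mul_le _ _).trans
    (mul_le_of_le_one_left (norm_nonneg _) (hu1 k))
  rw [e]
  have h3 := norm_sub_le (u k * (c - x) + (u k * x - x)) (c - x)
  have h4 := norm_add_le (u k * (c - x)) (u k * x - x)
  linarith

lemma mem_closure_of_tendsto_u {B : Set A} (hB : IsInclusion B) {h : A} {u : ℕ → A}
    (hu : ∀ k, star (u k) = u k) (hu1 : ∀ k, ‖u k‖ ≤ 1)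
    (huv : ∀ k, ∃ v ∈ B, u k = h * v ∧ u k = v * h) {z : A} (hz : z ∈ B)
    (h1 : Tendsto (fun k => u k * z) atTop (𝓝 z))
    (h2 : Tendsto (fun k => u k * star z) atTop (𝓝 (star z))) :
    z ∈ closure (twoSidedImage h h B) := by
  have h2' : Tendsto (fun k => z * u k) atTop (𝓝 z) := by
    have := (continuous_star.tendsto (star z)).comp h2
    simpa [Function.comp_def, hu] using this
  have h3 : Tendsto (fun k => u k * z * u k) atTop (𝓝 z) := by
    rw [tendsto_iff_norm_sub_tendsto_zero] at *
    refine squeeze_zero (fun k => norm_nonneg _) (fun k => ?_) (by simpa using h1.add h2')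
    have e : u k * z * u k - z = (u k * z - z) * u k + (z * u k - z) := by noncomm_ring
    rw [e]
    refine (norm_add_le _ _).trans ?_
    gcongr
    exact (norm_mul_le _ _).trans (mul_le_of_le_one_right (norm_nonneg _) (hu1 k))
  refine mem_closure_of_tendsto h3 (Eventually.of_forall fun k => ?_)
  obtain ⟨v, hv, e1, e2⟩ := huv k
  refine ⟨v * z * v, hB.mul_mem _ (hB.mul_mem _ hv _ hz) _ hv, ?_⟩
  nth_rewrite 1 [e1]
  rw [e2]
  simp only [mul_assoc]

lemma closure_eq_h {B : Set A} (hB : IsInclusion B) {h : A} (hh : 0 ≤ h) (hhB : h ∈ B)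
    {x : A} (hx : IsNormalizer B x) (hxh : x * star x = h) :
    closure (twoSidedImage x (star x) B) = closure (twoSidedImage h h B) := by
  obtain ⟨u, hu, hu1, huv, ht⟩ := exists_seq hB hh hhB
  have htx : Tendsto (fun k => u k * x) atTop (𝓝 x) := tendsto_u hu hu1 (by rwa [hxh])
  have key : ∀ b : A, Tendsto (fun k => u k * (x * b * star x)) atTop (𝓝 (x * b * star x)) := by
    intro b
    have := htx.mul_const (b * star x)
    simpa only [mul_assoc] using this
  apply subset_antisymm
  · refine closure_minimal ?_ isClosed_closure
    rintro _ ⟨b, hb, rfl⟩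
    refine mem_closure_of_tendsto_u hB hu hu1 huv (hx.1 b hb) (key b) ?_
    have : star (x * b * star x) = x * star b * star x := by simp [mul_assoc]
    rw [this]; exact key _
  · refine closure_mono ?_
    rintro _ ⟨b, hb, rfl⟩
    exact ⟨star x * b * x, hx.2 b hb, by simp only [← hxh, mul_assoc]⟩

lemma hereditary_h {B : Set A} (hB : IsInclusion B) {h : A} (hh : 0 ≤ h) (hhB : h ∈ B)
    {a c : A} (ha : a ∈ B) (hc : c ∈ closure (twoSidedImage h h B)) (ha0 : 0 ≤ a) (hac : a ≤ c) :
    a ∈ closure (twoSidedImage h h B) := by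
  obtain ⟨u, hu, hu1, huv, ht⟩ := exists_seq hB hh hhB
  have htc : Tendsto (fun k => u k * c) atTop (𝓝 c) := by
    refine tendsto_closure hu1 ?_ hc
    rintro _ ⟨b, hb, rfl⟩
    simpa only [mul_assoc] using ht.mul_const (b * h)
  have hca : 0 ≤ c - a := sub_nonneg.2 hac
  obtain ⟨s, hs0, hs⟩ : ∃ s : A, 0 ≤ s ∧ s * s = a :=
    ⟨CFC.sqrt a, CFC.sqrt_nonneg a, CFC.sqrt_mul_sqrt_self a ha0⟩
  obtain ⟨t, ht0, hts⟩ : ∃ s : A, 0 ≤ s ∧ s * s = c - a :=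
    ⟨CFC.sqrt (c - a), CFC.sqrt_nonneg _, CFC.sqrt_mul_sqrt_self _ hca⟩
  have hss : star s = s := (IsSelfAdjoint.of_nonneg hs0).star_eq
  have htt : star t = t := (IsSelfAdjoint.of_nonneg ht0).star_eq
  have hbound : ∀ k, ‖u k * s - s‖ ^ 2 ≤ 2 * ‖u k * c - c‖ := by
    intro k
    have e : (u k * s - s) * star (u k * s - s) + (u k * t - t) * star (u k * t - t)
        = (u k * c - c) * u k - (u k * c - c) := by
      have hcc : c = s * s + t * t := by rw [hs, hts]; abel
      rw [star_sub, star_mul, hu, hss, star_sub, star_mul, hu, htt, hcc]; noncomm_ring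
    have hle : (u k * s - s) * star (u k * s - s) ≤ (u k * c - c) * u k - (u k * c - c) := by
      rw [← e]; exact le_add_of_nonneg_right (mul_star_self_nonneg _)
    rw [pow_two, ← CStarRing.norm_self_mul_star]
    refine (CStarAlgebra.norm_le_norm_of_nonneg_of_le (mul_star_self_nonneg _) hle).trans ?_
    refine (norm_sub_le _ _).trans ?_
    have := (norm_mul_le (u k * c - c) (u k)).trans
      (mul_le_of_le_one_right (norm_nonneg _) (hu1 k))
    linarith
  have hts : Tendsto (fun k => u k * s) atTop (𝓝 s) := by
    rw [tendsto_iff_norm_sub_tendsto_zero] at htc ⊢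
    refine tendsto_of_sq (fun k => norm_nonneg _) ?_
    exact squeeze_zero (fun k => sq_nonneg _) hbound (by simpa using htc.const_mul 2)
  have hta : Tendsto (fun k => u k * a) atTop (𝓝 a) := by
    have := hts.mul_const s
    simpa only [mul_assoc, hs] using this
  refine mem_closure_of_tendsto_u hB hu hu1 huv ha hta ?_
  rwa [(IsSelfAdjoint.of_nonneg ha0).star_eq]

lemma mul_star_mem {B : Set A} (hB : IsInclusion B) {n : A} (hn : IsNormalizer B n) :
    n * star n ∈ B := by
  rw [← hB.isClosed.closure_eq, Metric.mem_closure_iff]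
  intro ε hε
  obtain ⟨e, he, -, -, h⟩ := hB.approxUnit {star n} (ε / (‖n‖ + 1)) (by positivity)
  have h := h (star n) (by simp)
  refine ⟨n * e * star n, hn.1 e he, ?_⟩
  rw [dist_comm, dist_eq_norm, mul_assoc, ← mul_sub]
  refine (norm_mul_le _ _).trans_lt ?_
  rw [lt_div_iff₀ (by positivity)] at h
  nlinarith [norm_nonneg (e * star n - star n)]

end Helpers


/-- If `(A,B)` is an inclusion of C*-algebras and `n` is a normalizer of `B`,
then the closure of `n B n*` is a hereditary C*-subalgebra of `B`, and it coincides with the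
closure of `|n*| B |n*|`, where `|n*| = (n n*)^{1/2}` (encoded as any `m ≥ 0` with
`m * m = n * n*`). -/
theorem closure_conj_hereditary_and_eq
    {A : Type*} [NonUnitalCStarAlgebra A] [PartialOrder A] [StarOrderedRing A]
    (B : Set A) (hB : IsInclusion B) (n : A) (hn : IsNormalizer B n)
    (m : A) (hm : 0 ≤ m) (hmsq : m * m = n * star n) :
    closure (twoSidedImage n (star n) B) ⊆ B ∧
    (∀ x ∈ closure (twoSidedImage n (star n) B), ∀ y ∈ closure (twoSidedImage n (star n) B),
      x + y ∈ closure (twoSidedImage n (star n) B)) ∧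
    (∀ x ∈ closure (twoSidedImage n (star n) B), ∀ y ∈ closure (twoSidedImage n (star n) B),
      x * y ∈ closure (twoSidedImage n (star n) B)) ∧
    (∀ (c : ℂ), ∀ x ∈ closure (twoSidedImage n (star n) B),
      c • x ∈ closure (twoSidedImage n (star n) B)) ∧
    (∀ x ∈ closure (twoSidedImage n (star n) B),
      star x ∈ closure (twoSidedImage n (star n) B)) ∧
    (∀ a c : A, a ∈ B → c ∈ closure (twoSidedImage n (star n) B) → 0 ≤ a → a ≤ c →
      a ∈ closure (twoSidedImage n (star n) B)) ∧
    closure (twoSidedImage n (star n) B) = closure (twoSidedImage m m B) := by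
  have hhB : n * star n ∈ B := mul_star_mem hB hn
  have hh : 0 ≤ n * star n := mul_star_self_nonneg n
  have hms : star m = m := (IsSelfAdjoint.of_nonneg hm).star_eq
  have hmB : m ∈ B := by
    have : m = cfcₙ Real.sqrt (n * star n) := by
      rw [← CFC.sqrt_eq_real_sqrt _ hh, ← hmsq, CFC.sqrt_mul_self m hm]
    rw [this]; exact hB.cfc_mem _ hhB
  have hmN : IsNormalizer B m := by
    constructor <;> intro b hb <;> rw [hms] <;>
      exact hB.mul_mem _ (hB.mul_mem _ hmB _ hb) _ hmB
  have hcm := closure_eq_h hB hh hhB hmN (by rw [hms, hmsq])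
  rw [hms] at hcm
  rw [closure_eq_h hB hh hhB hn rfl, hcm]
  have hhs : star (n * star n) = n * star n := (IsSelfAdjoint.of_nonneg hh).star_eq
  generalize n * star n = h at *
  refine ⟨?_, ?_, ?_, ?_, ?_, ?_, rfl⟩
  · refine closure_minimal ?_ hB.isClosed
    rintro _ ⟨b, hb, rfl⟩
    exact hB.mul_mem _ (hB.mul_mem _ hhB _ hb) _ hhB
  · intro x hx y hy
    refine map_mem_closure₂ continuous_add hx hy ?_
    rintro _ ⟨b, hb, rfl⟩ _ ⟨b', hb', rfl⟩
    exact ⟨b + b', hB.add_mem _ hb _ hb', by simp only [mul_add, add_mul]⟩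
  · intro x hx y hy
    refine map_mem_closure₂ continuous_mul hx hy ?_
    rintro _ ⟨b, hb, rfl⟩ _ ⟨b', hb', rfl⟩
    exact ⟨b * h * h * b', hB.mul_mem _ (hB.mul_mem _ (hB.mul_mem _ hb _ hhB) _ hhB) _ hb',
      by simp only [mul_assoc]⟩
  · intro c x hx
    refine map_mem_closure (continuous_const_smul c) hx ?_
    rintro _ ⟨b, hb, rfl⟩
    exact ⟨c • b, hB.smul_mem _ _ hb, by simp only [mul_smul_comm, smul_mul_assoc]⟩
  · intro x hx
    refine map_mem_closure continuous_star hx ?_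
    rintro _ ⟨b, hb, rfl⟩
    exact ⟨star b, hB.star_mem _ hb, by simp only [star_mul, hhs, mul_assoc]⟩
  · intro a c ha hc ha0 hac
    exact hereditary_h hB hh hhB ha hc ha0 hac
end

section
/- Let (A,B) be an inclusion of C*-algebras, let n ∈ N(A,B) be a normalizer, and write |n*| = (n n*)^{1/2} ∈ B. Then for every b ∈ B, |n*| b |n*| = 0 if and only if n* b n = 0. -/
/-- Right multiplication by `m` and by `n` have the same kernel when `m m* = n n*`. -/
theorem mul_eq_zero_iff_of_mul_star_eq {A : Type*} [NonUnitalCStarAlgebra A]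
    {m n : A} (h : m * star m = n * star n) (y : A) : y * m = 0 ↔ y * n = 0 := by
  have key : (y * m) * star (y * m) = (y * n) * star (y * n) := by
    calc (y * m) * star (y * m) = y * (m * star m) * star y := by
          simp only [star_mul, mul_assoc]
      _ = y * (n * star n) * star y := by rw [h]
      _ = (y * n) * star (y * n) := by simp only [star_mul, mul_assoc]
  rw [← CStarRing.mul_star_self_eq_zero_iff (y * m), key,
    CStarRing.mul_star_self_eq_zero_iff]

/-- If `(A,B)` is an inclusion of C*-algebras, `n` is a normalizer of `B`,
and `|n*| = (n n*)^{1/2}` (encoded as any `m ≥ 0` with `m * m = n * n*`), then for every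
`b ∈ B` one has `|n*| b |n*| = 0` if and only if `n* b n = 0`. -/
theorem absConj_eq_zero_iff_conj_eq_zero
    {A : Type*} [NonUnitalCStarAlgebra A] [PartialOrder A] [StarOrderedRing A]
    (B : Set A) (hB : IsInclusion B) (n : A) (hn : IsNormalizer B n)
    (m : A) (hm : 0 ≤ m) (hmsq : m * m = n * star n)
    (b : A) (hb : b ∈ B) :
    m * b * m = 0 ↔ star n * b * n = 0 := by
  have hs : star m = m := (IsSelfAdjoint.of_nonneg hm).star_eq
  have h : m * star m = n * star n := by rw [hs, hmsq]
  rw [mul_eq_zero_iff_of_mul_star_eq h (m * b), ← star_eq_zero,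
    ← star_eq_zero (x := star n * b * n)]
  have e1 : star (m * b * n) = (star n * star b) * m := by
    simp only [star_mul, hs, mul_assoc]
  have e2 : star (star n * b * n) = (star n * star b) * n := by
    simp only [star_mul, star_star, mul_assoc]
  rw [e1, e2]
  exact mul_eq_zero_iff_of_mul_star_eq h _
end

section
/- Let (A,B) be an inclusion of C*-algebras, let n ∈ N(A,B) be a normalizer, and write |n*| = (n n*)^{1/2} ∈ B. Then for every b ∈ B, ‖n* b n‖ = ‖ |n*| b |n*| ‖. -/
/-- If `(A,B)` is an inclusion of C*-algebras, `n` is a normalizer of `B`,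
and `|n*| = (n n*)^{1/2}` (encoded as any `m ≥ 0` with `m * m = n * n*`), then for every
`b ∈ B` one has `‖n* b n‖ = ‖ |n*| b |n*| ‖`. -/
theorem norm_conj_eq_norm_absConj
    {A : Type*} [NonUnitalCStarAlgebra A] [PartialOrder A] [StarOrderedRing A]
    (B : Set A) (hB : IsInclusion B) (n : A) (hn : IsNormalizer B n)
    (m : A) (hm : 0 ≤ m) (hmsq : m * m = n * star n)
    (b : A) (hb : b ∈ B) :
    ‖star n * b * n‖ = ‖m * b * m‖ := by
  have key : ∀ x y a : A, x * star x = y * star y → ‖a * x‖ = ‖a * y‖ := by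
    intro x y a h
    have h1 : a * x * star (a * x) = a * y * star (a * y) := by
      calc a * x * star (a * x) = a * (x * star x) * star a := by
            simp only [star_mul, mul_assoc]
        _ = a * (y * star y) * star a := by rw [h]
        _ = a * y * star (a * y) := by simp only [star_mul, mul_assoc]
    have h2 := CStarRing.norm_self_mul_star (x := a * x)
    have h3 := CStarRing.norm_self_mul_star (x := a * y)
    rw [h1, h3] at h2
    exact ((mul_self_inj (norm_nonneg _) (norm_nonneg _)).1 h2).symm
  have hms : star m = m := (IsSelfAdjoint.of_nonneg hm).star_eq
  have hnm : n * star n = m * star m := by rw [hms, hmsq]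
  calc ‖star n * b * n‖ = ‖star n * b * m‖ := key _ _ _ hnm
    _ = ‖star (star n * b * m)‖ := (norm_star _).symm
    _ = ‖star (b * m) * n‖ := by simp only [star_mul, star_star, mul_assoc]
    _ = ‖star (b * m) * m‖ := key _ _ _ hnm
    _ = ‖star (m * b * m)‖ := by simp only [star_mul, hms, mul_assoc]
    _ = ‖m * b * m‖ := norm_star _
end

section
/- Let (A,B) be an inclusion of C*-algebras and let n ∈ N(A,B) be a normalizer. Then the map |n*| b |n*| ↦ n* b n (b ∈ B) is well-defined and extends uniquely to a *-isomorphism θ_n from the closure of nBn* onto the closure of n*Bn, satisfying θ_n(|n*| b |n*|) = n* b n for all b ∈ B. -/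
/-- The defining properties of the map `θ_n`: it is a bijection from the closure of `n B n*`
onto the closure of `n* B n`, it is additive, multiplicative, ℂ-homogeneous and
star-preserving there, and it sends `|n*| b |n*|` to `n* b n` for every `b ∈ B`. -/
def ThetaSpec {A : Type*} [NonUnitalCStarAlgebra A] [PartialOrder A] [StarOrderedRing A]
    (B : Set A) (n m : A) (θ : A → A) : Prop :=
  Set.BijOn θ (closure (twoSidedImage n (star n) B)) (closure (twoSidedImage (star n) n B)) ∧
  (∀ x ∈ closure (twoSidedImage n (star n) B), ∀ y ∈ closure (twoSidedImage n (star n) B),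
    θ (x + y) = θ x + θ y) ∧
  (∀ x ∈ closure (twoSidedImage n (star n) B), ∀ y ∈ closure (twoSidedImage n (star n) B),
    θ (x * y) = θ x * θ y) ∧
  (∀ (c : ℂ), ∀ x ∈ closure (twoSidedImage n (star n) B), θ (c • x) = c • θ x) ∧
  (∀ x ∈ closure (twoSidedImage n (star n) B), θ (star x) = star (θ x)) ∧
  (∀ b ∈ B, θ (m * b * m) = star n * b * n)

open Filter Topology

section Helpers

variable {A : Type*} [NonUnitalCStarAlgebra A] [PartialOrder A] [StarOrderedRing A]

/-- The subalgebra with carrier `B`. -/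
def inclAlg (B : Set A) (hB : IsInclusion B) : NonUnitalStarSubalgebra ℂ A where
  carrier := B
  zero_mem' := hB.zero_mem
  add_mem' := fun {x y} hx hy => hB.add_mem x hx y hy
  smul_mem' := fun c {x} hx => hB.smul_mem c x hx
  mul_mem' := fun {x y} hx hy => hB.mul_mem x hx y hy
  star_mem' := fun {x} hx => hB.star_mem x hx

lemma incl_cfc_mem (B : Set A) (hB : IsInclusion B) (f : ℝ → ℝ) {a : A} (ha : a ∈ B) :
    cfcₙ f a ∈ B := by
  have : IsClosed ((inclAlg B hB : NonUnitalStarSubalgebra ℂ A) : Set A) := hB.isClosed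
  exact cfcₙ_mem (𝕜' := ℂ) (s := inclAlg B hB) f (a := a) ha

lemma normalizer_mul_star_mem (B : Set A) (hB : IsInclusion B) (n : A) (hn : IsNormalizer B n) :
    n * star n ∈ B := by
  have h : ∀ k : ℕ, ∃ e ∈ B, ‖e * star n - star n‖ ≤ 1 / ((k : ℝ) + 1) := by
    intro k
    obtain ⟨e, he, -, -, h⟩ := hB.approxUnit {star n} (1 / ((k : ℝ) + 1)) (by positivity)
    exact ⟨e, he, (h _ (by simp)).le⟩
  choose e he hle using h
  have ht : Tendsto (fun k => e k * star n) atTop (𝓝 (star n)) := by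
    rw [tendsto_iff_norm_sub_tendsto_zero]
    exact squeeze_zero (fun _ => norm_nonneg _) hle tendsto_one_div_add_atTop_nhds_zero_nat
  refine hB.isClosed.mem_of_tendsto (ht.const_mul n) (Eventually.of_forall fun k => ?_)
  simpa [mul_assoc] using hn.1 (e k) (he k)

lemma abs_mem (B : Set A) (hB : IsInclusion B) (n : A) (hn : IsNormalizer B n)
    (m : A) (hm : 0 ≤ m) (hmsq : m * m = n * star n) : m ∈ B := by
  have h := CFC.sqrt_unique hmsq hm
  rw [CFC.sqrt_eq_real_sqrt _ (mul_star_self_nonneg n)] at h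
  rw [← h]
  exact incl_cfc_mem B hB _ (normalizer_mul_star_mem B hB n hn)

lemma exists_approx (B : Set A) (hB : IsInclusion B) (m : A) (hm : 0 ≤ m) (hmB : m ∈ B)
    (ε : ℝ) (hε : 0 < ε) :
    ∃ p ∈ B, star p = p ∧ p * m = m * p ∧ ‖m * p * m - m‖ ≤ ε := by
  have hsa : IsSelfAdjoint m := hm.isSelfAdjoint
  have hpos : ∀ t : ℝ, 0 < t ^ 2 + ε ^ 2 := fun t => by positivity
  have hc : Continuous (fun t : ℝ => t / (t ^ 2 + ε ^ 2)) :=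
    continuous_id.div (by fun_prop) (fun t => (hpos t).ne')
  have hc' := hc.continuousOn (s := quasispectrum ℝ m)
  have h0 : (fun t : ℝ => t / (t ^ 2 + ε ^ 2)) 0 = 0 := by simp
  have hidm : cfcₙ (fun t : ℝ => t) m = m := cfcₙ_id' ℝ m
  have h1 : cfcₙ (fun t : ℝ => t * (t / (t ^ 2 + ε ^ 2))) m
      = m * cfcₙ (fun t : ℝ => t / (t ^ 2 + ε ^ 2)) m := by
    rw [cfcₙ_mul (fun t : ℝ => t) _ m (by fun_prop) rfl hc' h0, hidm]
  have h1' : cfcₙ (fun t : ℝ => (t / (t ^ 2 + ε ^ 2)) * t) m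
      = cfcₙ (fun t : ℝ => t / (t ^ 2 + ε ^ 2)) m * m := by
    rw [cfcₙ_mul _ (fun t : ℝ => t) m hc' h0 (by fun_prop) rfl, hidm]
  have hcm : Continuous (fun t : ℝ => t * (t / (t ^ 2 + ε ^ 2))) := continuous_id.mul hc
  have h2 : cfcₙ (fun t : ℝ => t * (t / (t ^ 2 + ε ^ 2)) * t) m
      = m * cfcₙ (fun t : ℝ => t / (t ^ 2 + ε ^ 2)) m * m := by
    rw [cfcₙ_mul _ (fun t : ℝ => t) m hcm.continuousOn (by simp) (by fun_prop) rfl, hidm, h1]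
  have h3 : cfcₙ (fun t : ℝ => t * (t / (t ^ 2 + ε ^ 2)) * t - t) m
      = m * cfcₙ (fun t : ℝ => t / (t ^ 2 + ε ^ 2)) m * m - m := by
    rw [cfcₙ_sub (fun t : ℝ => t * (t / (t ^ 2 + ε ^ 2)) * t) (fun t : ℝ => t) m
      (hcm.mul continuous_id : Continuous (fun t : ℝ => t * (t / (t ^ 2 + ε ^ 2)) * t)).continuousOn
      (by simp)      (by fun_prop) rfl, hidm, h2]
  refine ⟨cfcₙ (fun t : ℝ => t / (t ^ 2 + ε ^ 2)) m, incl_cfc_mem B hB _ hmB,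
    (cfcₙ_predicate (R := ℝ) _ m).star_eq, ?_, ?_⟩
  · rw [← h1, ← h1']
    congr 1
    ext t
    ring
  · rw [← h3]
    refine norm_cfcₙ_le fun t _ => ?_
    have : t * (t / (t ^ 2 + ε ^ 2)) * t - t = - (t * ε ^ 2 / (t ^ 2 + ε ^ 2)) := by
      field_simp [(hpos t).ne']
      ring
    rw [this, norm_neg, Real.norm_eq_abs, abs_div, abs_of_pos (hpos t), div_le_iff₀ (hpos t),
      abs_mul, abs_of_pos (by positivity : (0 : ℝ) < ε ^ 2)]
    nlinarith [sq_nonneg (|t| - ε), sq_abs t, abs_nonneg t, mul_pos hε hε,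
      mul_nonneg hε.le (sq_nonneg (|t| - ε)), mul_nonneg (abs_nonneg t) (mul_pos hε hε).le,
      mul_nonneg hε.le (sq_nonneg t), pow_pos hε 3]

lemma exists_approx_seq (B : Set A) (hB : IsInclusion B) (m : A) (hm : 0 ≤ m) (hmB : m ∈ B) :
    ∃ p : ℕ → A, (∀ k, p k ∈ B) ∧ (∀ k, star (p k) = p k) ∧ (∀ k, p k * m = m * p k) ∧
      Tendsto (fun k => m * p k * m) atTop (𝓝 m) := by
  have h := fun k : ℕ => exists_approx B hB m hm hmB (1 / ((k : ℝ) + 1)) (by positivity)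
  choose p h1 h2 h3 h4 using h
  refine ⟨p, h1, h2, h3, ?_⟩
  rw [tendsto_iff_norm_sub_tendsto_zero]
  exact squeeze_zero (fun _ => norm_nonneg _) h4 tendsto_one_div_add_atTop_nhds_zero_nat

lemma closure_eq (B : Set A) (hB : IsInclusion B) (n : A) (hn : IsNormalizer B n)
    (m : A) (hm : 0 ≤ m) (hmsq : m * m = n * star n) :
    closure (twoSidedImage n (star n) B) = closure (twoSidedImage m m B) := by
  have hmB := abs_mem B hB n hn m hm hmsq
  have hms : star m = m := hm.isSelfAdjoint.star_eq
  obtain ⟨p, hpB, hps, hpm, hp⟩ := exists_approx_seq B hB m hm hmB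
  apply subset_antisymm
  · refine closure_minimal ?_ isClosed_closure
    rintro _ ⟨b, hb, rfl⟩
    have hpn : Tendsto (fun k => m * p k * n) atTop (𝓝 n) := by
      rw [tendsto_iff_norm_sub_tendsto_zero] at hp ⊢
      refine hp.congr fun k => ?_
      have key : (m * p k * n - n) * star (m * p k * n - n)
          = (m * p k * m - m) * star (m * p k * m - m) := by
        simp only [star_sub, star_mul, hps, hms, sub_mul, mul_sub]
        simp only [mul_assoc]
        simp only [← mul_assoc n (star n), ← hmsq, mul_assoc]
      have e1 := CStarRing.norm_self_mul_star (x := m * p k * n - n)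
      have e2 := CStarRing.norm_self_mul_star (x := m * p k * m - m)
      rw [key, e2] at e1
      exact (mul_self_inj_of_nonneg (norm_nonneg _) (norm_nonneg _)).1 e1
    have ht : Tendsto (fun k => (m * p k * n) * b * star (m * p k * n)) atTop
        (𝓝 (n * b * star n)) := (hpn.mul_const b).mul hpn.star
    refine mem_closure_of_tendsto ht (Eventually.of_forall fun k => ?_)
    refine ⟨p k * (n * b * star n) * p k,
      hB.mul_mem _ (hB.mul_mem _ (hpB k) _ (hn.1 b hb)) _ (hpB k), ?_⟩
    simp only [star_mul, hps, hms, mul_assoc]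
  · refine closure_minimal ?_ isClosed_closure
    rintro _ ⟨b, hb, rfl⟩
    have ht : Tendsto (fun k => (m * p k * m) * b * (m * p k * m)) atTop
        (𝓝 (m * b * m)) := (hp.mul_const b).mul hp
    refine mem_closure_of_tendsto ht (Eventually.of_forall fun k => ?_)
    refine ⟨star n * (p k * b * p k) * n,
      hn.2 _ (hB.mul_mem _ (hB.mul_mem _ (hpB k) _ hb) _ (hpB k)), ?_⟩
    have e1 : m * p k * m = n * star n * p k := by rw [mul_assoc, hpm, ← mul_assoc, hmsq]
    have e2 : m * p k * m = p k * (n * star n) := by rw [← hpm, mul_assoc, hmsq]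
    show n * (star n * (p k * b * p k) * n) * star n = m * p k * m * b * (m * p k * m)
    conv_rhs => rw [e2]
    rw [show p k * (n * star n) * b = m * p k * m * b by rw [e2], e1]
    simp only [mul_assoc]

/-- The generating graph. -/
def thetaGraph (B : Set A) (n m : A) : Set (A × A) :=
  (fun b => (m * b * m, star n * b * n)) '' B

lemma norm_eq_graph (n m b : A) (hms : star m = m) (hmsq : m * m = n * star n) :
    ‖m * b * m‖ = ‖star n * b * n‖ := by
  have e1 : ‖m * b * n‖ = ‖m * b * m‖ := by
    have k1 := CStarRing.norm_self_mul_star (x := m * b * n)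
    have k2 := CStarRing.norm_self_mul_star (x := m * b * m)
    have key : (m * b * n) * star (m * b * n) = (m * b * m) * star (m * b * m) := by
      simp only [star_mul, hms, mul_assoc]
      simp only [← mul_assoc n (star n), ← hmsq, mul_assoc]
    rw [key, k2] at k1
    exact ((mul_self_inj_of_nonneg (norm_nonneg _) (norm_nonneg _)).1 k1).symm
  have e2 : ‖star n * b * n‖ = ‖m * b * n‖ := by
    have k1 := CStarRing.norm_star_mul_self (x := star n * b * n)
    have k2 := CStarRing.norm_star_mul_self (x := m * b * n)
    have key : star (star n * b * n) * (star n * b * n) = star (m * b * n) * (m * b * n) := by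
      simp only [star_mul, star_star, hms, mul_assoc]
      simp only [← mul_assoc n (star n), ← hmsq, mul_assoc]
    rw [key, k2] at k1
    exact ((mul_self_inj_of_nonneg (norm_nonneg _) (norm_nonneg _)).1 k1).symm
  rw [← e1, e2]

lemma graph_norm (B : Set A) (n m : A) (hms : star m = m) (hmsq : m * m = n * star n) :
    ∀ z ∈ closure (thetaGraph B n m), ‖z.1‖ = ‖z.2‖ := by
  have hcl : IsClosed {z : A × A | ‖z.1‖ = ‖z.2‖} :=
    isClosed_eq (by fun_prop) (by fun_prop)
  refine closure_minimal ?_ hcl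
  rintro _ ⟨b, hb, rfl⟩
  exact norm_eq_graph n m b hms hmsq

lemma graph_add (B : Set A) (hB : IsInclusion B) (n m : A) :
    ∀ z ∈ closure (thetaGraph B n m), ∀ w ∈ closure (thetaGraph B n m),
      z + w ∈ closure (thetaGraph B n m) := by
  intro z hz w hw
  refine map_mem_closure₂ continuous_add hz hw ?_
  rintro _ ⟨b, hb, rfl⟩ _ ⟨c, hc, rfl⟩
  exact ⟨b + c, hB.add_mem _ hb _ hc, by simp [mul_add, add_mul]⟩

lemma graph_smul (B : Set A) (hB : IsInclusion B) (n m : A) (c : ℂ) :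
    ∀ z ∈ closure (thetaGraph B n m), c • z ∈ closure (thetaGraph B n m) := by
  intro z hz
  refine map_mem_closure (continuous_const_smul c) hz ?_
  rintro _ ⟨b, hb, rfl⟩
  exact ⟨c • b, hB.smul_mem _ _ hb, by simp [mul_smul_comm, smul_mul_assoc]⟩

lemma graph_star (B : Set A) (hB : IsInclusion B) (n m : A) (hms : star m = m) :
    ∀ z ∈ closure (thetaGraph B n m), star z ∈ closure (thetaGraph B n m) := by
  intro z hz
  refine map_mem_closure continuous_star hz ?_
  rintro _ ⟨b, hb, rfl⟩
  exact ⟨star b, hB.star_mem _ hb, by ext <;> simp [hms, mul_assoc]⟩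

lemma graph_mul (B : Set A) (hB : IsInclusion B) (n m : A) (hn : IsNormalizer B n)
    (hmsq : m * m = n * star n) :
    ∀ z ∈ closure (thetaGraph B n m), ∀ w ∈ closure (thetaGraph B n m),
      z * w ∈ closure (thetaGraph B n m) := by
  intro z hz w hw
  refine map_mem_closure₂ continuous_mul hz hw ?_
  rintro _ ⟨b, hb, rfl⟩ _ ⟨c, hc, rfl⟩
  refine ⟨b * (n * star n) * c,
    hB.mul_mem _ (hB.mul_mem _ hb _ (normalizer_mul_star_mem B hB n hn)) _ hc, ?_⟩
  ext
  · simp only [Prod.fst_mul, ← hmsq, mul_assoc]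
  · simp only [Prod.snd_mul, mul_assoc]

lemma graph_sub (B : Set A) (hB : IsInclusion B) (n m : A) :
    ∀ z ∈ closure (thetaGraph B n m), ∀ w ∈ closure (thetaGraph B n m),
      z - w ∈ closure (thetaGraph B n m) := by
  intro z hz w hw
  have := graph_add B hB n m z hz _ (graph_smul B hB n m (-1) w hw)
  simpa [sub_eq_add_neg] using this

lemma graph_fst (B : Set A) (hB : IsInclusion B) (n m : A) (hms : star m = m)
    (hmsq : m * m = n * star n) :
    Prod.fst '' closure (thetaGraph B n m) = closure (twoSidedImage m m B) := by
  have himg : Prod.fst '' thetaGraph B n m = twoSidedImage m m B := by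
    simp [thetaGraph, twoSidedImage, Set.image_image]
  apply subset_antisymm
  · rw [← himg]
    exact image_closure_subset_closure_image continuous_fst
  · refine closure_minimal (himg ▸ Set.image_mono subset_closure) ?_
    have hiso : Isometry (fun z : closure (thetaGraph B n m) => (z : A × A).1) := by
      refine Isometry.of_dist_eq fun z w => ?_
      have := graph_norm B n m hms hmsq _ (graph_sub B hB n m _ z.2 _ w.2)
      rw [Subtype.dist_eq, dist_eq_norm, dist_eq_norm, Prod.norm_def, ← this]
      simp
    have : CompleteSpace (closure (thetaGraph B n m)) := isClosed_closure.completeSpace_coe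
    have h := hiso.isClosedEmbedding.isClosed_range
    convert h using 1
    ext x
    simp

lemma graph_snd (B : Set A) (hB : IsInclusion B) (n m : A) (hms : star m = m)
    (hmsq : m * m = n * star n) :
    Prod.snd '' closure (thetaGraph B n m) = closure (twoSidedImage (star n) n B) := by
  have himg : Prod.snd '' thetaGraph B n m = twoSidedImage (star n) n B := by
    simp [thetaGraph, twoSidedImage, Set.image_image]
  apply subset_antisymm
  · rw [← himg]
    exact image_closure_subset_closure_image continuous_snd
  · refine closure_minimal (himg ▸ Set.image_mono subset_closure) ?_
    have hiso : Isometry (fun z : closure (thetaGraph B n m) => (z : A × A).2) := by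
      refine Isometry.of_dist_eq fun z w => ?_
      have := graph_norm B n m hms hmsq _ (graph_sub B hB n m _ z.2 _ w.2)
      rw [Subtype.dist_eq, dist_eq_norm, dist_eq_norm, Prod.norm_def, this]
      simp
    have : CompleteSpace (closure (thetaGraph B n m)) := isClosed_closure.completeSpace_coe
    have h := hiso.isClosedEmbedding.isClosed_range
    convert h using 1
    ext x
    simp

/-- A star-homomorphism defined on a closed star-subalgebra is contractive. -/
lemma contractive (C : NonUnitalStarSubalgebra ℂ A) (hC : IsClosed (C : Set A)) (θ : A → A)
    (hadd : ∀ x ∈ C, ∀ y ∈ C, θ (x + y) = θ x + θ y)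
    (hmul : ∀ x ∈ C, ∀ y ∈ C, θ (x * y) = θ x * θ y)
    (hsmul : ∀ (c : ℂ), ∀ x ∈ C, θ (c • x) = c • θ x)
    (hstar : ∀ x ∈ C, θ (star x) = star (θ x)) (x : A) (hx : x ∈ C) : ‖θ x‖ ≤ ‖x‖ := by
  let φ : C →⋆ₙₐ[ℂ] A :=
    { toFun := fun z => θ z
      map_smul' := fun c z => hsmul c z z.2
      map_zero' := by
        have := hsmul 0 0 C.zero_mem
        simpa using this
      map_add' := fun z w => hadd z z.2 w w.2
      map_mul' := fun z w => hmul z z.2 w w.2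
      map_star' := fun z => hstar z z.2 }
  exact NonUnitalStarAlgHom.norm_apply_le φ ⟨x, hx⟩

end Helpers

/-- If `(A,B)` is an inclusion of C*-algebras, `n` is a normalizer of `B`,
and `|n*| = (n n*)^{1/2}` (encoded as any `m ≥ 0` with `m * m = n * n*`), then the map
`|n*| b |n*| ↦ n* b n` is well defined and extends uniquely to a *-isomorphism `θ_n` from
the closure of `n B n*` onto the closure of `n* B n`. -/
theorem exists_unique_theta
    {A : Type*} [NonUnitalCStarAlgebra A] [PartialOrder A] [StarOrderedRing A]
    (B : Set A) (hB : IsInclusion B) (n : A) (hn : IsNormalizer B n)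
    (m : A) (hm : 0 ≤ m) (hmsq : m * m = n * star n) :
    ∃ θ : A → A, ThetaSpec B n m θ ∧
      ∀ θ' : A → A, ThetaSpec B n m θ' →
        ∀ x ∈ closure (twoSidedImage n (star n) B), θ' x = θ x := by
  have hms : star m = m := hm.isSelfAdjoint.star_eq
  have hcl := closure_eq B hB n hn m hm hmsq
  have hfst := graph_fst B hB n m hms hmsq
  have hsnd := graph_snd B hB n m hms hmsq
  have hN := graph_norm B n m hms hmsq
  have hS := graph_sub B hB n m
  have hG : ∀ x, ∃ y, x ∈ closure (twoSidedImage n (star n) B) →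
      (x, y) ∈ closure (thetaGraph B n m) := by
    intro x
    by_cases hx : x ∈ closure (twoSidedImage n (star n) B)
    · have hx' := hx
      rw [hcl, ← hfst] at hx'
      obtain ⟨⟨a, b⟩, h, rfl⟩ := hx'
      exact ⟨b, fun _ => h⟩
    · exact ⟨0, fun h => absurd h hx⟩
  choose θ hθ using hG
  have hmem : ∀ z ∈ closure (thetaGraph B n m), z.1 ∈ closure (twoSidedImage n (star n) B) := by
    intro z hz
    rw [hcl, ← hfst]
    exact ⟨z, hz, rfl⟩
  have hval : ∀ x y, (x, y) ∈ closure (thetaGraph B n m) → θ x = y := by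
    intro x y h
    have h1 := hN _ (hS _ (hθ x (hmem _ h)) _ h)
    simp only [Prod.mk_sub_mk, sub_self, norm_zero] at h1
    exact sub_eq_zero.1 (norm_eq_zero.1 h1.symm)
  have hspec : ThetaSpec B n m θ := by
    refine ⟨⟨?_, ?_, ?_⟩, ?_, ?_, ?_, ?_, ?_⟩
    · intro x hx
      rw [← hsnd]
      exact ⟨_, hθ x hx, rfl⟩
    · intro x hx y hy hxy
      have h1 := hN _ (hS _ (hθ x hx) _ (hθ y hy))
      simp only [Prod.mk_sub_mk, hxy, sub_self, norm_zero] at h1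
      exact sub_eq_zero.1 (norm_eq_zero.1 h1)
    · intro y hy
      rw [← hsnd] at hy
      obtain ⟨⟨a, b⟩, h, rfl⟩ := hy
      exact ⟨a, hmem _ h, hval _ _ h⟩
    · exact fun x hx y hy => hval _ _ (graph_add B hB n m _ (hθ x hx) _ (hθ y hy))
    · exact fun x hx y hy => hval _ _ (graph_mul B hB n m hn hmsq _ (hθ x hx) _ (hθ y hy))
    · exact fun c x hx => hval _ _ (graph_smul B hB n m c _ (hθ x hx))
    · exact fun x hx => hval _ _ (graph_star B hB n m hms _ (hθ x hx))
    · exact fun b hb => hval _ _ (subset_closure ⟨b, hb, rfl⟩)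
  refine ⟨θ, hspec, ?_⟩
  let C : NonUnitalStarSubalgebra ℂ A :=
    { carrier := closure (twoSidedImage n (star n) B)
      zero_mem' := subset_closure ⟨0, hB.zero_mem, by simp⟩
      add_mem' := fun {x y} hx hy => hmem _ (graph_add B hB n m _ (hθ x hx) _ (hθ y hy))
      mul_mem' := fun {x y} hx hy =>
        hmem _ (graph_mul B hB n m hn hmsq _ (hθ x hx) _ (hθ y hy))
      smul_mem' := fun c {x} hx => hmem _ (graph_smul B hB n m c _ (hθ x hx))
      star_mem' := fun {x} hx => hmem _ (graph_star B hB n m hms _ (hθ x hx)) }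
  have hCc : IsClosed (C : Set A) := isClosed_closure
  have hcontr : ∀ η : A → A, ThetaSpec B n m η → ∀ x ∈ C, ∀ y ∈ C, ‖η x - η y‖ ≤ ‖x - y‖ := by
    rintro η ⟨-, ha, hmu, hsm, hst, -⟩ x hx y hy
    have h1 := contractive C hCc η ha hmu hsm hst (x - y) (sub_mem hx hy)
    have h2 := ha (x - y) (sub_mem hx hy) y hy
    rw [sub_add_cancel] at h2
    rwa [h2, add_sub_cancel_right]
  intro θ' hθ' x hx
  have hxm := hx
  rw [hcl] at hxm
  rw [← sub_eq_zero, ← norm_le_zero_iff]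
  refine le_of_forall_pos_le_add fun ε hε => ?_
  obtain ⟨_, ⟨b, hb, rfl⟩, hd⟩ := Metric.mem_closure_iff.1 hxm (ε / 2) (by positivity)
  have hs : m * b * m ∈ C := hmem (m * b * m, star n * b * n) (subset_closure ⟨b, hb, rfl⟩)
  have h1 := hcontr θ' hθ' x hx _ hs
  have h2 := hcontr θ hspec x hx _ hs
  rw [hθ'.2.2.2.2.2 b hb] at h1
  rw [hspec.2.2.2.2.2 b hb] at h2
  rw [dist_eq_norm] at hd
  have h3 := norm_sub_le (θ' x - star n * b * n) (θ x - star n * b * n)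
  rw [sub_sub_sub_cancel_right] at h3
  simp only at hd
  linarith
end

section
/- Let (A,D) be an inclusion of C*-algebras with D abelian, let J be a closed (two-sided) ideal of D, and let n ∈ N(A,D) be a normalizer satisfying n J n* ⊆ J and n* J n ⊆ J. Then J n ⊆ closure(n J) and n J ⊆ closure(J n), where n J = {n x : x ∈ J} and J n = {x n : x ∈ J}. -/
lemma aux_approx {A : Type*} [NonUnitalCStarAlgebra A] [PartialOrder A] [StarOrderedRing A]
    (T : NonUnitalStarSubalgebra ℝ A) (hT : IsClosed (T : Set A)) (n : A)
    (hn : n * star n ∈ T) (ε : ℝ) (hε : 0 < ε) :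
    ∃ e ∈ T, star e = e ∧ ‖e * n - n‖ < ε := by
  set a := n * star n with ha
  have hsa : IsSelfAdjoint a := IsSelfAdjoint.mul_star_self n
  set δ : ℝ := ε ^ 2 / 4 with hδ
  have hδ0 : 0 < δ := by positivity
  let f : ℝ → ℝ := fun t => t ^ 2 / (t ^ 2 + δ ^ 2)
  have hpos : ∀ t : ℝ, 0 < t ^ 2 + δ ^ 2 := fun t => by positivity
  have hf : Continuous f := by
    apply Continuous.div (by fun_prop) (by fun_prop)
    intro t; exact (hpos t).ne'
  have hf0 : f 0 = 0 := by simp [f]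
  have hfb : ∀ t, ‖f t‖ ≤ 1 := by
    intro t
    have : 0 ≤ f t := by have := hpos t; simp only [f]; positivity
    rw [Real.norm_of_nonneg this]
    simp only [f]
    rw [div_le_one (hpos t)]
    nlinarith
  have hfd : ∀ t, ‖f t * t - t‖ ≤ δ := by
    intro t
    have h1 : f t * t - t = - (δ ^ 2 * t) / (t ^ 2 + δ ^ 2) := by
      simp only [f]
      have := (hpos t).ne'
      field_simp
      ring
    rw [h1, Real.norm_eq_abs, abs_div, abs_of_pos (hpos t), div_le_iff₀ (hpos t), abs_le]
    constructor <;> nlinarith [sq_nonneg (t - δ), sq_nonneg (t + δ), sq_nonneg t,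
      mul_nonneg hδ0.le (sq_nonneg (t - δ)), mul_nonneg hδ0.le (sq_nonneg (t + δ)),
      mul_nonneg hδ0.le (sq_nonneg t), mul_nonneg hδ0.le (sq_nonneg δ)]
  have he : cfcₙ f a ∈ T :=
    NonUnitalStarAlgebra.elemental.le_of_mem (R := ℝ) hT hn (cfcₙ_mem_elemental f a)
  have hesa : star (cfcₙ f a) = cfcₙ f a := cfcₙ_predicate (p := IsSelfAdjoint) f a
  refine ⟨cfcₙ f a, he, hesa, ?_⟩
  have hmul : cfcₙ f a * a - a = cfcₙ (fun t => f t * t - t) a := by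
    rw [cfcₙ_sub (fun t => f t * t) (fun t => t) a (by fun_prop) (by simp) (by fun_prop) rfl,
      cfcₙ_mul f (fun t => t) a (by fun_prop) hf0 (by fun_prop) rfl, cfcₙ_id' ℝ a]
  have hd : ‖cfcₙ f a * a - a‖ ≤ δ := by
    rw [hmul]; exact norm_cfcₙ_le fun t _ => hfd t
  have he1 : ‖cfcₙ f a‖ ≤ 1 := norm_cfcₙ_le fun t _ => hfb t
  set e := cfcₙ f a
  have key : (e * n - n) * star (e * n - n) = (e * a - a) * e - (e * a - a) := by
    rw [star_sub, star_mul, hesa, ha]; noncomm_ring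
  have h2 : ‖e * n - n‖ * ‖e * n - n‖ ≤ 2 * δ := by
    rw [← CStarRing.norm_self_mul_star, key]
    calc _ ≤ ‖(e * a - a) * e‖ + ‖e * a - a‖ := norm_sub_le _ _
      _ ≤ ‖e * a - a‖ * ‖e‖ + ‖e * a - a‖ := by gcongr; exact norm_mul_le _ _
      _ ≤ δ * 1 + δ := by gcongr
      _ = 2 * δ := by ring
  have := norm_nonneg (e * n - n)
  nlinarith

lemma aux_mem {A : Type*} [NonUnitalCStarAlgebra A] [PartialOrder A] [StarOrderedRing A]
    (D : Set A) (hD : IsInclusion D) (n : A) (hn : ∀ b ∈ D, n * b * star n ∈ D) :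
    n * star n ∈ D := by
  rw [← hD.isClosed.closure_eq, Metric.mem_closure_iff]
  intro ε hε
  obtain ⟨e, heD, -, -, he⟩ := hD.approxUnit {star n} (ε / (‖n‖ + 1)) (by positivity)
  have he := he (star n) (by simp)
  refine ⟨n * e * star n, hn e heD, ?_⟩
  rw [dist_comm, dist_eq_norm, mul_assoc, ← mul_sub]
  rw [lt_div_iff₀ (by positivity)] at he
  have := norm_mul_le n (e * star n - star n)
  have := norm_nonneg (e * star n - star n)
  nlinarith

/-- A closed real star subalgebra of self-adjoint elements of `D` stable under a condition. -/
def auxSub {A : Type*} [NonUnitalCStarAlgebra A] [PartialOrder A] [StarOrderedRing A]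
    (D : Set A) (hD : IsInclusion D) (habel : ∀ x ∈ D, ∀ y ∈ D, x * y = y * x)
    (P : A → Prop) (h0 : P 0) (hadd : ∀ x y, P x → P y → P (x + y))
    (hsmul : ∀ (c : ℂ) x, P x → P (c • x))
    (hmul : ∀ x ∈ D, ∀ y ∈ D, P x → P y → P (x * y)) :
    NonUnitalStarSubalgebra ℝ A where
  carrier := {b | b ∈ D ∧ star b = b ∧ P b}
  zero_mem' := ⟨hD.zero_mem, star_zero _, h0⟩
  add_mem' := by
    rintro x y ⟨h1, h2, h3⟩ ⟨h4, h5, h6⟩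
    exact ⟨hD.add_mem _ h1 _ h4, by rw [star_add, h2, h5], hadd _ _ h3 h6⟩
  smul_mem' := by
    rintro c x ⟨h1, h2, h3⟩
    refine ⟨?_, by rw [star_smul, h2, star_trivial], ?_⟩
    · exact hD.smul_mem (c : ℂ) x h1
    · exact hsmul (c : ℂ) x h3
  mul_mem' := by
    rintro x y ⟨h1, h2, h3⟩ ⟨h4, h5, h6⟩
    exact ⟨hD.mul_mem _ h1 _ h4, by rw [star_mul, h2, h5, habel _ h1 _ h4],
      hmul _ h1 _ h4 h3 h6⟩
  star_mem' := by
    rintro x ⟨h1, h2, h3⟩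
    change star x ∈ D ∧ star (star x) = star x ∧ P (star x)
    rw [h2]
    exact ⟨h1, h2, h3⟩

lemma aux_exists {A : Type*} [NonUnitalCStarAlgebra A] [PartialOrder A] [StarOrderedRing A]
    (D : Set A) (hD : IsInclusion D) (habel : ∀ x ∈ D, ∀ y ∈ D, x * y = y * x)
    (P : A → Prop) (h0 : P 0) (hadd : ∀ x y, P x → P y → P (x + y))
    (hsmul : ∀ (c : ℂ) x, P x → P (c • x))
    (hmul : ∀ x ∈ D, ∀ y ∈ D, P x → P y → P (x * y)) (hcl : IsClosed {x | P x})
    (n : A) (hn : ∀ b ∈ D, n * b * star n ∈ D) (hP : P (n * star n)) (ε : ℝ) (hε : 0 < ε) :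
    ∃ e, P e ∧ star e = e ∧ ‖e * n - n‖ < ε := by
  obtain ⟨e, ⟨-, -, h⟩, h2, h3⟩ := aux_approx (auxSub D hD habel P h0 hadd hsmul hmul)
    (hD.isClosed.inter ((isClosed_eq continuous_star continuous_id).inter hcl)) n
    ⟨aux_mem D hD n hn, by simp, hP⟩ ε hε
  exact ⟨e, h, h2, h3⟩

lemma aux_closure {A : Type*} [NonUnitalCStarAlgebra A] (J : Set A)
    (h0 : (0 : A) ∈ J) (hadd : ∀ x ∈ J, ∀ y ∈ J, x + y ∈ J)
    (hsmul : ∀ (c : ℂ), ∀ x ∈ J, c • x ∈ J) (L : A →ₗ[ℂ] A) :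
    ∃ S : Submodule ℂ A, (S : Set A) = closure (L '' J) := by
  let J' : Submodule ℂ A :=
    { carrier := J, zero_mem' := h0, add_mem' := fun {x y} hx hy => hadd x hx y hy
      smul_mem' := hsmul }
  exact ⟨(J'.map L).topologicalClosure, rfl⟩

/-- Let `(A,D)` be an inclusion of C*-algebras with `D` abelian, let `J` be a
closed two-sided ideal of `D`, and let `n` be a normalizer of `D` with `n J n* ⊆ J` and
`n* J n ⊆ J`.  Then `J n ⊆ closure (n J)` and `n J ⊆ closure (J n)`. -/
theorem ideal_intertwine
    {A : Type*} [NonUnitalCStarAlgebra A] [PartialOrder A] [StarOrderedRing A]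
    (D : Set A) (hD : IsInclusion D) (habel : ∀ x ∈ D, ∀ y ∈ D, x * y = y * x)
    (J : Set A) (hJ : IsClosedIdealOf D J)
    (n : A) (hn : IsNormalizer D n)
    (h₁ : ∀ x ∈ J, n * x * star n ∈ J) (h₂ : ∀ x ∈ J, star n * x * n ∈ J) :
    (∀ x ∈ J, x * n ∈ closure ((fun y => n * y) '' J)) ∧
    (∀ x ∈ J, n * x ∈ closure ((fun y => y * n) '' J)) := by
  constructor
  · obtain ⟨S, hS⟩ := aux_closure J hJ.zero_mem hJ.add_mem hJ.smul_mem (LinearMap.mulLeft ℂ n)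
    change (S : Set A) = closure ((fun y => n * y) '' J) at hS
    have hSc : IsClosed (S : Set A) := hS ▸ isClosed_closure
    have hJS : ∀ y ∈ J, n * y ∈ S := fun y hy => by
      rw [← SetLike.mem_coe, hS]; exact subset_closure ⟨y, hy, rfl⟩
    rw [← hS]
    intro x hx
    change x * n ∈ (S : Set A)
    rw [← hSc.closure_eq, Metric.mem_closure_iff]
    intro ε hε
    obtain ⟨e, hP, -, he⟩ := aux_exists D hD habel (fun b => ∀ x ∈ J, x * b * n ∈ S)
      (by intro x _; simp)
      (by intro b c hb hc x hx; rw [mul_add, add_mul]; exact S.add_mem (hb x hx) (hc x hx))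
      (by
        intro c b hb x hx
        rw [mul_smul_comm, smul_mul_assoc]; exact S.smul_mem c (hb x hx))
      (by
        intro b hb c _ _ hPc x hx
        rw [← mul_assoc x b c]
        exact hPc _ (hJ.mul_right x hx b hb))
      (by
        simp only [Set.setOf_forall]
        exact isClosed_iInter fun x => isClosed_iInter fun _ => hSc.preimage (by fun_prop))
      n hn.1
      (by
        intro x hx
        rw [habel x (hJ.subset hx) _ (aux_mem D hD n hn.1)]
        have := hJS _ (h₂ x hx)
        simpa only [mul_assoc] using this)
      (ε / (‖x‖ + 1)) (by positivity)
    refine ⟨x * e * n, hP x hx, ?_⟩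
    rw [dist_comm, dist_eq_norm, mul_assoc, ← mul_sub]
    rw [lt_div_iff₀ (by positivity)] at he
    have := norm_mul_le x (e * n - n)
    have := norm_nonneg (e * n - n)
    nlinarith
  · obtain ⟨S, hS⟩ := aux_closure J hJ.zero_mem hJ.add_mem hJ.smul_mem (LinearMap.mulRight ℂ n)
    change (S : Set A) = closure ((fun y => y * n) '' J) at hS
    have hSc : IsClosed (S : Set A) := hS ▸ isClosed_closure
    have hJS : ∀ y ∈ J, y * n ∈ S := fun y hy => by
      rw [← SetLike.mem_coe, hS]; exact subset_closure ⟨y, hy, rfl⟩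
    have hn2 : ∀ b ∈ D, star n * b * star (star n) ∈ D := by
      simpa only [star_star] using hn.2
    rw [← hS]
    intro x hx
    change n * x ∈ (S : Set A)
    rw [← hSc.closure_eq, Metric.mem_closure_iff]
    intro ε hε
    obtain ⟨e, hP, hes, he⟩ := aux_exists D hD habel (fun b => ∀ x ∈ J, n * (b * x) ∈ S)
      (by intro x _; simp)
      (by intro b c hb hc x hx; rw [add_mul, mul_add]; exact S.add_mem (hb x hx) (hc x hx))
      (by
        intro c b hb x hx
        rw [smul_mul_assoc, mul_smul_comm]; exact S.smul_mem c (hb x hx))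
      (by
        intro b _ c hc hPb _ x hx
        rw [mul_assoc b c x]
        exact hPb _ (hJ.mul_left c hc x hx))
      (by
        simp only [Set.setOf_forall]
        exact isClosed_iInter fun x => isClosed_iInter fun _ => hSc.preimage (by fun_prop))
      (star n) hn2
      (by
        intro x hx
        rw [← habel x (hJ.subset hx) _ (aux_mem D hD (star n) hn2)]
        have := hJS _ (h₁ x hx)
        simpa only [mul_assoc, star_star] using this)
      (ε / (‖x‖ + 1)) (by positivity)
    have he' : ‖n * e - n‖ < ε / (‖x‖ + 1) := by
      rw [← norm_star, star_sub, star_mul, hes]; exact he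
    refine ⟨n * (e * x), hP x hx, ?_⟩
    rw [dist_comm, dist_eq_norm, ← mul_assoc, ← sub_mul]
    rw [lt_div_iff₀ (by positivity)] at he'
    have := norm_mul_le (n * e - n) x
    have := norm_nonneg (n * e - n)
    nlinarith
end

section
/- Let (A,D) be an inclusion of C*-algebras with D abelian, let J be a closed (two-sided) ideal of D, and let n ∈ N(A,D) be a normalizer satisfying n J n* ⊆ J and n* J n ⊆ J. Then n J^{⊥_D} n* ⊆ J^{⊥_D} and n* J^{⊥_D} n ⊆ J^{⊥_D}, where J^{⊥_D} = {d ∈ D : dJ = Jd = {0}}. In particular, if J is an invariant ideal of D (i.e., m J m* ⊆ J for every m ∈ N(A,D)), then J^{⊥_D} is an invariant ideal of D. -/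
theorem ann_aux
    {A : Type*} [NonUnitalCStarAlgebra A] [PartialOrder A] [StarOrderedRing A]
    (D : Set A) (hD : IsInclusion D) (habel : ∀ x ∈ D, ∀ y ∈ D, x * y = y * x)
    (J : Set A) (hJ : IsClosedIdealOf D J)
    (n : A) (hn : IsNormalizer D n) (h₂ : ∀ x ∈ J, star n * x * n ∈ J) :
    ∀ x ∈ Ann D J, n * x * star n ∈ Ann D J := by
  intro x hx
  have hy := hn.1 x hx.1
  refine ⟨hy, fun j hj => ?_⟩
  have hjj := h₂ _ (hJ.mul_right j hj _ (hD.star_mem j (hJ.subset hj)))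
  have h0 := (hx.2 _ hjj).1
  have hz : n * x * star n * j = 0 := by
    rw [← CStarRing.mul_star_self_eq_zero_iff]
    calc n * x * star n * j * star (n * x * star n * j)
        = n * (x * (star n * (j * star j) * n)) * (star x * star n) := by
          simp only [star_mul, star_star, mul_assoc]
      _ = 0 := by rw [h0]; simp
  exact ⟨hz, by rw [habel j (hJ.subset hj) _ hy, hz]⟩

/-- Let `(A,D)` be an inclusion of C*-algebras with `D` abelian, let `J` be a
closed two-sided ideal of `D`, and let `n` be a normalizer of `D` with `n J n* ⊆ J` and
`n* J n ⊆ J`.  Then `n J^{⊥_D} n* ⊆ J^{⊥_D}` and `n* J^{⊥_D} n ⊆ J^{⊥_D}`.  In particular,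
if `J` is an invariant ideal of `D`, then so is `J^{⊥_D}`. -/
theorem annihilator_invariant
    {A : Type*} [NonUnitalCStarAlgebra A] [PartialOrder A] [StarOrderedRing A]
    (D : Set A) (hD : IsInclusion D) (habel : ∀ x ∈ D, ∀ y ∈ D, x * y = y * x)
    (J : Set A) (hJ : IsClosedIdealOf D J)
    (n : A) (hn : IsNormalizer D n)
    (h₁ : ∀ x ∈ J, n * x * star n ∈ J) (h₂ : ∀ x ∈ J, star n * x * n ∈ J) :
    ((∀ x ∈ Ann D J, n * x * star n ∈ Ann D J) ∧
     (∀ x ∈ Ann D J, star n * x * n ∈ Ann D J)) ∧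
    (IsInvariantIdeal D J → IsInvariantIdeal D (Ann D J)) := by
  have hs : ∀ m : A, IsNormalizer D m → IsNormalizer D (star m) := fun m hm =>
    ⟨fun b hb => by simpa using hm.2 b hb, fun b hb => by simpa using hm.1 b hb⟩
  refine ⟨⟨ann_aux D hD habel J hJ n hn h₂, ?_⟩, ?_⟩
  · simpa using ann_aux D hD habel J hJ (star n) (hs n hn) (by simpa using h₁)
  · intro hinv m hm
    exact ann_aux D hD habel J hJ m hm (by simpa using hinv (star m) (hs m hm))
end

section
/- Let (A,D) be a pseudo-Cartan inclusion of C*-algebras and let J be a regular ideal of A. Then J ∩ D is an invariant regular ideal of D, i.e., J ∩ D is a closed two-sided ideal of D with (J ∩ D)^{⊥⊥_D} = J ∩ D and n (J ∩ D) n* ⊆ J ∩ D for every n ∈ N(A,D). -/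
section Helpers

variable {A : Type*} [NonUnitalCStarAlgebra A] [PartialOrder A] [StarOrderedRing A]

theorem isClosed_relComm (D : Set A) : IsClosed (RelComm D) := by
  have : RelComm D = ⋂ d ∈ D, {a : A | a * d = d * a} := by
    ext a; simp [RelComm]
  rw [this]
  refine isClosed_biInter fun d _ => ?_
  exact isClosed_eq (by fun_prop) (by fun_prop)

/-- The ideal intersection property passes to `(A, D)`. -/
theorem iip_trans (D : Set A) (hD : IsPseudoCartan D) :
    IdealIntersectionProperty (Set.univ : Set A) D := by
  intro J hJ hne
  have hR : IsClosedIdealOf (RelComm D) (J ∩ RelComm D) := by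
    have hmul : ∀ x ∈ RelComm D, ∀ y ∈ RelComm D, x * y ∈ RelComm D := by
      intro x hx y hy d hd
      rw [mul_assoc, hy d hd, ← mul_assoc, hx d hd, mul_assoc]
    refine ⟨Set.inter_subset_right, ⟨hJ.zero_mem, ?_⟩, ?_, ?_, ?_, ?_,
      hJ.isClosed.inter (isClosed_relComm D)⟩
    · intro d _; simp
    · rintro x ⟨hx, hx'⟩ y ⟨hy, hy'⟩
      refine ⟨hJ.add_mem x hx y hy, fun d hd => ?_⟩
      rw [add_mul, mul_add, hx' d hd, hy' d hd]
    · rintro c x ⟨hx, hx'⟩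
      refine ⟨hJ.smul_mem c x hx, fun d hd => ?_⟩
      rw [smul_mul_assoc, mul_smul_comm, hx' d hd]
    · rintro c hc x ⟨hx, hx'⟩
      exact ⟨hJ.mul_left c trivial x hx, hmul c hc x hx'⟩
    · rintro x ⟨hx, hx'⟩ c hc
      exact ⟨hJ.mul_right x hx c trivial, hmul x hx' c hc⟩
  obtain ⟨x, hx, hx0⟩ := hD.iip_A J hJ hne
  obtain ⟨y, hy, hy0⟩ := hD.iip_relComm _ hR ⟨x, hx, hx0⟩
  exact ⟨y, ⟨hy.1.1, hy.2⟩, hy0⟩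

theorem kill_mid (D : Set A) (hD : IsPseudoCartan D) (J : Set A)
    (hJ : IsClosedIdealOf (Set.univ : Set A) J) (e : A) (he : e ∈ Ann D (J ∩ D))
    (k : A) (hk : k ∈ J ∩ D) (b : A) : k * b * e = 0 := by
  have hcl : IsClosed {b : A | k * b * e = 0} := isClosed_eq (by fun_prop) (by fun_prop)
  have hsub : (↑(Submodule.span ℂ {n : A | IsNormalizer D n}) : Set A) ⊆
      {b : A | k * b * e = 0} := by
    intro b hb
    induction hb using Submodule.span_induction with
    | mem n hn =>
      have hm : star n * (star k * k) * n ∈ J ∩ D := by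
        refine ⟨hJ.mul_right _ (hJ.mul_left _ trivial _ (hJ.mul_left _ trivial _ hk.1)) _ trivial,
          hn.2 _ (hD.inclusion.mul_mem _ (hD.inclusion.star_mem _ hk.2) _ hk.2)⟩
      have h0 := (he.2 _ hm).2
      change k * n * e = 0
      rw [← CStarRing.star_mul_self_eq_zero_iff]
      calc star (k * n * e) * (k * n * e)
          = star e * (star n * (star k * k) * n * e) := by
            simp only [star_mul, mul_assoc]
        _ = 0 := by rw [h0, mul_zero]
    | zero => simp
    | add x y _ _ hx hy =>
      have hx : k * x * e = 0 := hx
      have hy : k * y * e = 0 := hy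
      change k * (x + y) * e = 0
      rw [mul_add, add_mul, hx, hy, add_zero]
    | smul c x _ hx =>
      have hx : k * x * e = 0 := hx
      change k * (c • x) * e = 0
      rw [mul_smul_comm, smul_mul_assoc, hx, smul_zero]
  have := hcl.closure_subset_iff.2 hsub
  exact this (hD.regular b)

theorem ann_inter (D : Set A) (hD : IsPseudoCartan D) (J : Set A)
    (hJ : IsClosedIdealOf (Set.univ : Set A) J) :
    Ann D (J ∩ D) = Ann Set.univ J ∩ D := by
  ext e
  refine ⟨fun he => ?_, fun he => ⟨he.2, fun x hx => he.1.2 x hx.1⟩⟩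
  let I : Set A := {a | a ∈ J ∧ ∀ k ∈ J ∩ D, ∀ b : A, k * b * a = 0}
  have hI : IsClosedIdealOf (Set.univ : Set A) I := by
    refine ⟨Set.subset_univ _, ⟨hJ.zero_mem, by simp⟩, ?_, ?_, ?_, ?_, ?_⟩
    · rintro x ⟨hx, hx'⟩ y ⟨hy, hy'⟩
      exact ⟨hJ.add_mem x hx y hy, fun k hk b => by rw [mul_add, hx' k hk b, hy' k hk b, add_zero]⟩
    · rintro c x ⟨hx, hx'⟩
      exact ⟨hJ.smul_mem c x hx, fun k hk b => by rw [mul_smul_comm, hx' k hk b, smul_zero]⟩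
    · rintro c - x ⟨hx, hx'⟩
      exact ⟨hJ.mul_left c trivial x hx, fun k hk b => by
        rw [← mul_assoc, mul_assoc k b c, hx' k hk]⟩
    · rintro x ⟨hx, hx'⟩ c -
      exact ⟨hJ.mul_right x hx c trivial, fun k hk b => by
        rw [← mul_assoc, hx' k hk, zero_mul]⟩
    · have : I = J ∩ ⋂ k ∈ J ∩ D, ⋂ b : A, {a : A | k * b * a = 0} := by
        ext a; simp [I]
      rw [this]
      refine hJ.isClosed.inter (isClosed_biInter fun k _ => isClosed_iInter fun b => ?_)
      exact isClosed_eq (by fun_prop) (by fun_prop)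
  have hI0 : ∀ x ∈ I, x = 0 := by
    by_contra! hne
    obtain ⟨a, ⟨haI, haD⟩, ha0⟩ := iip_trans D hD I hI hne
    have h := haI.2 a ⟨haI.1, haD⟩ (star a)
    apply ha0
    rw [← CStarRing.star_mul_self_eq_zero_iff, ← CStarRing.star_mul_self_eq_zero_iff]
    calc star (star a * a) * (star a * a) = star a * (a * star a * a) := by
          simp only [star_mul, star_star, mul_assoc]
      _ = 0 := by rw [h, mul_zero]
  refine ⟨⟨trivial, fun j hj => ⟨hI0 _ ⟨hJ.mul_left e trivial j hj, fun k hk b => ?_⟩,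
    hI0 _ ⟨hJ.mul_right j hj e trivial, fun k hk b => ?_⟩⟩⟩, he.1⟩
  · rw [← mul_assoc, kill_mid D hD J hJ e he k hk b, zero_mul]
  · rw [← mul_assoc, mul_assoc k b j, kill_mid D hD J hJ e he k hk]

theorem ann_ideal (J : Set A) (hJ : IsClosedIdealOf (Set.univ : Set A) J) :
    IsClosedIdealOf (Set.univ : Set A) (Ann Set.univ J) := by
  refine ⟨Set.subset_univ _, ⟨trivial, by simp⟩, ?_, ?_, ?_, ?_, ?_⟩
  · rintro x ⟨-, hx⟩ y ⟨-, hy⟩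
    exact ⟨trivial, fun j hj => by simp [add_mul, mul_add, hx j hj, hy j hj]⟩
  · rintro c x ⟨-, hx⟩
    exact ⟨trivial, fun j hj => by simp [smul_mul_assoc, mul_smul_comm, hx j hj]⟩
  · rintro c - x ⟨-, hx⟩
    exact ⟨trivial, fun j hj => ⟨by rw [mul_assoc, (hx j hj).1, mul_zero], by
      rw [← mul_assoc, (hx _ (hJ.mul_right j hj c trivial)).2]⟩⟩
  · rintro x ⟨-, hx⟩ c -
    exact ⟨trivial, fun j hj => ⟨by rw [mul_assoc, (hx _ (hJ.mul_left c trivial j hj)).1], by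
      rw [← mul_assoc, (hx j hj).2, zero_mul]⟩⟩
  · have : Ann Set.univ J = ⋂ j ∈ J, ({a : A | a * j = 0} ∩ {a : A | j * a = 0}) := by
      ext a; simp [Ann]
    rw [this]
    refine isClosed_biInter fun j _ => IsClosed.inter ?_ ?_
    · exact isClosed_eq (by fun_prop) (by fun_prop)
    · exact isClosed_eq (by fun_prop) (by fun_prop)

end Helpers

/-- Let `(A,D)` be a pseudo-Cartan inclusion and let `J` be a regular ideal
of `A`.  Then `J ∩ D` is an invariant regular ideal of `D`: it is a closed two-sided ideal
of `D` with `(J ∩ D)^{⊥⊥_D} = J ∩ D`, and `n (J ∩ D) n* ⊆ J ∩ D` for every normalizer `n`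
of `D`. -/
theorem inter_invariant_regular
    {A : Type*} [NonUnitalCStarAlgebra A] [PartialOrder A] [StarOrderedRing A]
    (D : Set A) (hD : IsPseudoCartan D)
    (J : Set A) (hJ : IsRegularIdealOf (Set.univ : Set A) J) :
    IsClosedIdealOf D (J ∩ D) ∧ Ann D (Ann D (J ∩ D)) = J ∩ D ∧
      IsInvariantIdeal D (J ∩ D) := by
  obtain ⟨hI, hreg⟩ := hJ
  have hDi := hD.inclusion
  refine ⟨⟨Set.inter_subset_right, ⟨hI.zero_mem, hDi.zero_mem⟩, ?_, ?_, ?_, ?_,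
    hI.isClosed.inter hDi.isClosed⟩, ?_, ?_⟩
  · rintro x ⟨hx, hx'⟩ y ⟨hy, hy'⟩
    exact ⟨hI.add_mem x hx y hy, hDi.add_mem x hx' y hy'⟩
  · rintro c x ⟨hx, hx'⟩
    exact ⟨hI.smul_mem c x hx, hDi.smul_mem c x hx'⟩
  · rintro c hc x ⟨hx, hx'⟩
    exact ⟨hI.mul_left c trivial x hx, hDi.mul_mem c hc x hx'⟩
  · rintro x ⟨hx, hx'⟩ c hc
    exact ⟨hI.mul_right x hx c trivial, hDi.mul_mem x hx' c hc⟩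
  · rw [ann_inter D hD J hI, ann_inter D hD _ (ann_ideal J hI), hreg]
  · rintro n hn x ⟨hx, hx'⟩
    exact ⟨hI.mul_right _ (hI.mul_left n trivial x hx) _ trivial, hn.1 x hx'⟩
end

section
/- Let (A,D) be a pseudo-Cartan inclusion with Cartan envelope (A₁, D₁, α), and let J be an invariant regular ideal of D. Then α(J)^{⊥⊥_{D₁}} (double annihilator computed in D₁) is an invariant ideal of D₁, i.e., m (α(J)^{⊥⊥_{D₁}}) m* ⊆ α(J)^{⊥⊥_{D₁}} for every m ∈ N(A₁,D₁). -/
section Cartan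

variable {A : Type*} [NonUnitalCStarAlgebra A] [PartialOrder A] [StarOrderedRing A]
variable {A₁ : Type*} [NonUnitalCStarAlgebra A₁] [PartialOrder A₁] [StarOrderedRing A₁]

/-- `E` is a faithful conditional expectation of `A₁` onto `D₁`. -/
structure IsCondExp (D₁ : Set A₁) (E : A₁ → A₁) : Prop where
  map_add : ∀ x y : A₁, E (x + y) = E x + E y
  map_smul : ∀ (c : ℂ) (x : A₁), E (c • x) = c • E x
  mem : ∀ a : A₁, E a ∈ D₁
  fixes : ∀ d ∈ D₁, E d = d
  bimodule : ∀ d ∈ D₁, ∀ a : A₁, ∀ d' ∈ D₁, E (d * a * d') = d * E a * d'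
  positive : ∀ a : A₁, 0 ≤ a → 0 ≤ E a
  faithful : ∀ a : A₁, E (star a * a) = 0 → a = 0

/-- `(A₁, D₁)` is a Cartan inclusion with faithful conditional expectation `E`:
a regular inclusion with `D₁` maximal abelian admitting a faithful conditional
expectation onto `D₁`. -/
structure IsCartanInclusion (D₁ : Set A₁) (E : A₁ → A₁) : Prop where
  regularInclusion : IsRegularInclusion D₁
  abelian : ∀ x ∈ D₁, ∀ y ∈ D₁, x * y = y * x
  maximalAbelian : ∀ a : A₁, (∀ d ∈ D₁, a * d = d * a) → a ∈ D₁
  condExp : IsCondExp D₁ E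

/-- The C*-subalgebra generated by a subset `S`. -/
def GeneratedCStar (S : Set A₁) : Set A₁ :=
  closure (NonUnitalStarAlgebra.adjoin ℂ S : Set A₁)

/-- `(A₁, D₁, α)`, with faithful conditional expectation `E : A₁ → D₁`, is a Cartan
envelope of `(A, D)`. -/
structure IsCartanEnvelope (D : Set A) (D₁ : Set A₁) (α : A →⋆ₙₐ[ℂ] A₁) (E : A₁ → A₁) :
    Prop where
  cartan : IsCartanInclusion D₁ E
  injective : Function.Injective α
  maps : ∀ d ∈ D, α d ∈ D₁
  regular_morphism : ∀ n : A, IsNormalizer D n → IsNormalizer D₁ (α n)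
  generates : GeneratedCStar (Set.range ⇑α ∪ E '' Set.range ⇑α) = (Set.univ : Set A₁)
  generatesD : D₁ = GeneratedCStar (E '' Set.range ⇑α)
  iip : IdealIntersectionProperty D₁ (⇑α '' D)

end Cartan

section Helpers

variable {B : Type*} [NonUnitalCStarAlgebra B] [PartialOrder B] [StarOrderedRing B]

lemma aux_star_mul_self {y : B} (h : star y * y = 0) : y = 0 :=
  CStarRing.star_mul_self_eq_zero_iff y |>.1 h

lemma aux_mul_star_self {y : B} (h : y * star y = 0) : y = 0 :=
  CStarRing.mul_star_self_eq_zero_iff y |>.1 h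

lemma aux_prod {c e : B} (h : star c * c * (e * star e) = 0) : c * e = 0 := by
  apply aux_mul_star_self
  apply aux_star_mul_self
  have : star (c * e * star (c * e)) * (c * e * star (c * e))
      = c * e * star e * (star c * c * (e * star e)) * star c := by
    simp only [star_mul, star_star, mul_assoc]
  rw [this, h]; simp

lemma isNormalizer_mul {D : Set B} {m n : B} (hm : IsNormalizer D m)
    (hn : IsNormalizer D n) : IsNormalizer D (m * n) := by
  refine ⟨fun b hb => ?_, fun b hb => ?_⟩
  · have := hm.1 _ (hn.1 b hb)
    simpa only [star_mul, mul_assoc] using this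
  · have := hn.2 _ (hm.2 b hb)
    simpa only [star_mul, mul_assoc] using this

lemma isNormalizer_star {D : Set B} {m : B} (hm : IsNormalizer D m) :
    IsNormalizer D (star m) :=
  ⟨fun b hb => by simpa using hm.2 b hb, fun b hb => by simpa using hm.1 b hb⟩

lemma ann_star {D X : Set B} (hD : ∀ x ∈ D, star x ∈ D) (hX : ∀ x ∈ X, star x ∈ X) :
    ∀ x ∈ Ann D X, star x ∈ Ann D X := by
  intro x hx
  refine ⟨hD x hx.1, fun y hy => ?_⟩
  have h := hx.2 _ (hX y hy)
  constructor
  · have := congrArg star h.2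
    simpa using this
  · have := congrArg star h.1
    simpa using this

/-- The normalizers which do not connect `K` with `L`. -/
def goodSet (D K L : Set B) : Set B :=
  {m | IsNormalizer D m ∧ ∀ x ∈ K, ∀ l ∈ L, x * m * l = 0 ∧ l * m * x = 0}

lemma goodSet_star {D K L : Set B} (hK : ∀ x ∈ K, star x ∈ K) (hL : ∀ x ∈ L, star x ∈ L)
    {m : B} (hm : m ∈ goodSet D K L) : star m ∈ goodSet D K L := by
  refine ⟨isNormalizer_star hm.1, fun x hx l hl => ?_⟩
  have h := hm.2 _ (hK x hx) _ (hL l hl)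
  constructor
  · have := congrArg star h.2
    simpa [mul_assoc] using this
  · have := congrArg star h.1
    simpa [mul_assoc] using this

lemma goodSet_mul_aux {D K L : Set B}
    (hmul : ∀ x ∈ D, ∀ y ∈ D, x * y ∈ D) (hst : ∀ x ∈ D, star x ∈ D)
    (hcomm : ∀ x ∈ D, ∀ y ∈ D, x * y = y * x)
    (hKD : K ⊆ D) (hLD : L ⊆ D)
    (hess : ∀ w ∈ D, (∀ x ∈ K, x * w = 0) → (∀ x ∈ L, x * w = 0) → w = 0)
    {m n : B} (hm : IsNormalizer D m) (hn : IsNormalizer D n)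
    {x l : B} (hx : x ∈ D) (hl : l ∈ D)
    (h : ∀ d, d ∈ K ∨ d ∈ L → x * m * d * n * l = 0) :
    x * (m * n) * l = 0 := by
  have key : x * m * (n * l) = 0 := by
    apply aux_prod
    have h1 : star (x * m) * (x * m) ∈ D := by
      have := hm.2 _ (hmul _ (hst x hx) _ hx)
      simpa only [star_mul, mul_assoc] using this
    have h2 : n * l * star (n * l) ∈ D := by
      have := hn.1 _ (hmul _ hl _ (hst l hl))
      simpa only [star_mul, mul_assoc] using this
    have h3 : ∀ d, d ∈ K ∨ d ∈ L →
        d * (star (x * m) * (x * m) * (n * l * star (n * l))) = 0 := by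
      intro d hd
      have hdD : d ∈ D := hd.elim (fun h => hKD h) (fun h => hLD h)
      rw [← mul_assoc, hcomm d hdD _ h1]
      have : star (x * m) * (x * m) * d * (n * l * star (n * l))
          = star (x * m) * (x * m * d * n * l) * star (n * l) := by
        simp only [mul_assoc]
      rw [this, h d hd]; simp
    exact hess _ (hmul _ h1 _ h2) (fun d hd => h3 d (Or.inl hd)) (fun d hd => h3 d (Or.inr hd))
  simpa only [mul_assoc] using key

lemma goodSet_mul {D K L : Set B}
    (hmul : ∀ x ∈ D, ∀ y ∈ D, x * y ∈ D) (hst : ∀ x ∈ D, star x ∈ D)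
    (hcomm : ∀ x ∈ D, ∀ y ∈ D, x * y = y * x)
    (hKD : K ⊆ D) (hLD : L ⊆ D)
    (hess : ∀ w ∈ D, (∀ x ∈ K, x * w = 0) → (∀ x ∈ L, x * w = 0) → w = 0)
    {m n : B} (hm : m ∈ goodSet D K L) (hn : n ∈ goodSet D K L) :
    m * n ∈ goodSet D K L := by
  refine ⟨isNormalizer_mul hm.1 hn.1, fun x hx l hl => ⟨?_, ?_⟩⟩
  · refine goodSet_mul_aux hmul hst hcomm hKD hLD hess hm.1 hn.1 (hKD hx) (hLD hl) ?_
    rintro d (hd | hd)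
    · have := (hn.2 d hd l hl).1
      have e : x * m * d * n * l = x * m * (d * n * l) := by simp only [mul_assoc]
      rw [e, this, mul_zero]
    · rw [(hm.2 x hx d hd).1]; simp
  · refine goodSet_mul_aux hmul hst hcomm hKD hLD hess hm.1 hn.1 (hLD hl) (hKD hx) ?_
    rintro d (hd | hd)
    · rw [(hm.2 d hd l hl).2]; simp
    · have := (hn.2 x hx d hd).2
      have e : l * m * d * n * x = l * m * (d * n * x) := by simp only [mul_assoc]
      rw [e, this, mul_zero]

/-- The closed span of the good set kills `K` against `L`. -/
lemma adjoin_goodSet {D K L : Set B}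
    (hK : ∀ x ∈ K, star x ∈ K) (hL : ∀ x ∈ L, star x ∈ L)
    (hgm : ∀ m ∈ goodSet D K L, ∀ n ∈ goodSet D K L, m * n ∈ goodSet D K L)
    {a : B} (ha : a ∈ closure (NonUnitalStarAlgebra.adjoin ℂ (goodSet D K L) : Set B))
    {x l : B} (hx : x ∈ K) (hl : l ∈ L) : x * a * l = 0 := by
  have hclosed : IsClosed {a : B | x * a * l = 0} :=
    isClosed_eq (by fun_prop) continuous_const
  refine closure_minimal ?_ hclosed ha
  intro b hb
  have hb' : b ∈ (NonUnitalStarAlgebra.adjoin ℂ (goodSet D K L)).toSubmodule := hb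
  rw [NonUnitalStarAlgebra.adjoin_eq_span] at hb'
  clear hb
  have hsub : ∀ y ∈ Subsemigroup.closure (goodSet D K L ∪ star (goodSet D K L)),
      y ∈ goodSet D K L := by
    intro y hy
    induction hy using Subsemigroup.closure_induction with
    | mem y hy =>
      rcases hy with hy | hy
      · exact hy
      · have := goodSet_star hK hL (Set.mem_star.1 hy)
        simpa using this
    | mul y z _ _ hy hz => exact hgm y hy z hz
  induction hb' using Submodule.span_induction with
  | mem y hy => exact ((hsub y hy).2 x hx l hl).1
  | zero => simp
  | add y z _ _ hy hz =>
    have hy' : x * y * l = 0 := hy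
    have hz' : x * z * l = 0 := hz
    simp [mul_add, add_mul, hy', hz']
  | smul c y _ hy =>
    have hy' : x * y * l = 0 := hy
    change x * (c • y) * l = 0
    rw [mul_smul_comm, smul_mul_assoc, hy', smul_zero]

end Helpers

/-- Let `(A,D)` be a pseudo-Cartan inclusion with Cartan envelope
`(A₁, D₁, α)` and let `J` be an invariant regular ideal of `D`.  Then
`α(J)^{⊥⊥_{D₁}}` is an invariant ideal of `D₁`. -/
theorem image_double_annihilator_invariant
    {A : Type*} [NonUnitalCStarAlgebra A] [PartialOrder A] [StarOrderedRing A]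
    {A₁ : Type*} [NonUnitalCStarAlgebra A₁] [PartialOrder A₁] [StarOrderedRing A₁]
    (D : Set A) (D₁ : Set A₁) (α : A →⋆ₙₐ[ℂ] A₁) (E : A₁ → A₁)
    (hD : IsPseudoCartan D) (henv : IsCartanEnvelope D D₁ α E)
    (J : Set A) (hJ : IsInvariantRegularIdeal D J) :
    IsInvariantIdeal D₁ (Ann D₁ (Ann D₁ (⇑α '' J))) := by
  obtain ⟨⟨hJi, -⟩, hJinv⟩ := hJ
  have hincl := henv.cartan.regularInclusion.1
  have hmul := hincl.mul_mem
  have hst := hincl.star_mem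
  have hcomm := henv.cartan.abelian
  -- products `star x * y` with `y ∈ J` stay in `J`, so `star j * j ∈ J`
  set L := Ann D₁ (⇑α '' J) with hLdef
  set K := Ann D₁ L with hKdef
  have hLD : L ⊆ D₁ := fun x hx => hx.1
  have hKD : K ⊆ D₁ := fun x hx => hx.1
  have hDst := hD.inclusion.star_mem
  -- a criterion for membership in `L`
  have hjj : ∀ j ∈ J, star j * j ∈ J := fun j hj =>
    hJi.mul_left _ (hDst _ (hJi.subset hj)) _ hj
  have hLst : ∀ x ∈ L, star x ∈ L := by
    intro x hx
    refine ⟨hst x hx.1, ?_⟩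
    rintro _ ⟨j, hj, rfl⟩
    have hjD := henv.maps j (hJi.subset hj)
    have h1 : star x * α j = 0 := by
      apply aux_star_mul_self
      have e : star (star x * α j) * (star x * α j) = star (α j) * (x * star x) * α j := by
        simp only [star_mul, star_star, mul_assoc]
      rw [e, hcomm x hx.1 _ (hst x hx.1)]
      have : star (α j) * (star x * x) * α j = star (α j) * star x * (x * α j) := by
        simp only [mul_assoc]
      rw [this, (hx.2 _ ⟨j, hj, rfl⟩).1, mul_zero]
    exact ⟨h1, by rw [hcomm _ hjD _ (hst x hx.1), h1]⟩
  have hKst : ∀ x ∈ K, star x ∈ K := ann_star hst hLst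
  have hess : ∀ w ∈ D₁, (∀ x ∈ K, x * w = 0) → (∀ x ∈ L, x * w = 0) → w = 0 := by
    intro w hw h1 h2
    have hwK : w ∈ K := ⟨hw, fun x hx => ⟨by rw [hcomm w hw x (hLD hx), h2 x hx], h2 x hx⟩⟩
    exact aux_star_mul_self (h1 _ (hKst w hwK))
  have hgm : ∀ m ∈ goodSet D₁ K L, ∀ n ∈ goodSet D₁ K L, m * n ∈ goodSet D₁ K L :=
    fun m hm n hn => goodSet_mul hmul hst hcomm hKD hLD hess hm hn
  have hDgood : D₁ ⊆ goodSet D₁ K L := by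
    intro d hd
    refine ⟨⟨fun b hb => hmul _ (hmul _ hd _ hb) _ (hst d hd),
      fun b hb => hmul _ (hmul _ (hst d hd) _ hb) _ hd⟩, fun x hx l hl => ⟨?_, ?_⟩⟩
    · rw [hcomm x (hKD hx) d hd, mul_assoc, (hx.2 l hl).1, mul_zero]
    · rw [hcomm l (hLD hl) d hd, mul_assoc, (hx.2 l hl).2, mul_zero]
  have hhalf : ∀ n : A, IsNormalizer D n → ∀ x ∈ K, ∀ l ∈ L, x * α n * l = 0 := by
    intro n hn x hx l hl
    have hn1 := henv.regular_morphism n hn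
    have h1 : ∀ j ∈ J, α j * α n * l = 0 := by
      intro j hj
      apply aux_star_mul_self
      have hz : star n * (star j * j) * n ∈ J := by
        have := hJinv (star n) (isNormalizer_star hn) _ (hjj j hj)
        simpa using this
      have e : star (α j * α n * l) * (α j * α n * l)
          = star l * (α (star n * (star j * j) * n) * l) := by
        simp only [star_mul, map_mul, map_star, mul_assoc]
      rw [e, (hl.2 _ ⟨_, hz, rfl⟩).2, mul_zero]
    have h2 : α n * (l * star l) * star (α n) ∈ L := by
      have hmem := hn1.1 _ (hmul _ hl.1 _ (hst l hl.1))
      refine ⟨hmem, ?_⟩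
      rintro _ ⟨j, hj, rfl⟩
      have hjD := henv.maps j (hJi.subset hj)
      have h3 : α j * (α n * (l * star l) * star (α n)) = 0 := by
        have e : α j * (α n * (l * star l) * star (α n))
            = α j * α n * l * (star l * star (α n)) := by simp only [mul_assoc]
        rw [e, h1 j hj, zero_mul]
      exact ⟨by rw [hcomm _ hmem _ hjD, h3], h3⟩
    apply aux_mul_star_self
    have e : x * α n * l * star (x * α n * l)
        = x * (α n * (l * star l) * star (α n)) * star x := by
      simp only [star_mul, mul_assoc]
    rw [e, (hx.2 _ h2).1, zero_mul]
  have hNgood : ∀ n : A, IsNormalizer D n → α n ∈ goodSet D₁ K L := by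
    intro n hn
    refine ⟨henv.regular_morphism n hn, fun x hx l hl => ⟨hhalf n hn x hx l hl, ?_⟩⟩
    have := congrArg star (hhalf (star n) (isNormalizer_star hn) _ (hKst x hx) _ (hLst l hl))
    simpa [mul_assoc, map_star] using this
  have hαcont : Continuous α := map_continuous α
  let P : NonUnitalStarSubalgebra ℂ A₁ := NonUnitalStarAlgebra.adjoin ℂ (goodSet D₁ K L)
  have hPsub : goodSet D₁ K L ⊆ P := NonUnitalStarAlgebra.subset_adjoin ℂ _
  have hrange : ∀ a : A, α a ∈ closure (P : Set A₁) := by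
    intro a
    have ha : a ∈ closure (↑(Submodule.span ℂ {n : A | IsNormalizer D n}) : Set A) :=
      hD.regular a
    refine map_mem_closure hαcont ha ?_
    intro b hb
    change α b ∈ P
    induction hb using Submodule.span_induction with
    | mem y hy => exact hPsub (hNgood y hy)
    | zero => rw [map_zero]; exact zero_mem P
    | add y z _ _ hy hz => rw [map_add]; exact add_mem hy hz
    | smul c y _ hy => rw [map_smul]; exact SMulMemClass.smul_mem c hy
  have hall : ∀ a : A₁, a ∈ closure (P : Set A₁) := by
    intro a
    have ha : a ∈ GeneratedCStar (Set.range ⇑α ∪ E '' Set.range ⇑α) := by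
      rw [henv.generates]; trivial
    have hle : NonUnitalStarAlgebra.adjoin ℂ (Set.range ⇑α ∪ E '' Set.range ⇑α)
        ≤ P.topologicalClosure := by
      apply NonUnitalStarAlgebra.adjoin_le
      rintro _ (⟨b, rfl⟩ | ⟨b, -, rfl⟩)
      · exact hrange b
      · exact subset_closure (hPsub (hDgood (henv.cartan.condExp.mem b)))
    exact closure_minimal (fun y hy => hle hy) isClosed_closure ha
  intro m hm x hx
  have hmem := hm.1 x (hKD hx)
  refine ⟨hmem, fun l hl => ?_⟩
  have h0 : m * x * star m * l = 0 := by
    have := adjoin_goodSet hKst hLst hgm (hall (star m)) hx hl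
    have e : m * x * star m * l = m * (x * star m * l) := by simp only [mul_assoc]
    rw [e, this, mul_zero]
  exact ⟨h0, by rw [hcomm _ (hLD hl) _ hmem, h0]⟩
end

section
/- Let (A,D) be a pseudo-Cartan inclusion with Cartan envelope (A₁, D₁, α), and let J₁ be an invariant regular ideal of D₁. Then α^{-1}(J₁) is an invariant regular ideal of D, i.e., α^{-1}(J₁) is a closed two-sided ideal of D equal to its double annihilator in D, and n α^{-1}(J₁) n* ⊆ α^{-1}(J₁) for every n ∈ N(A,D). -/
theorem ann_closedIdeal
    {A : Type*} [NonUnitalCStarAlgebra A] [PartialOrder A] [StarOrderedRing A]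
    (C X : Set A) (hC : IsInclusion C) (hab : ∀ x ∈ C, ∀ y ∈ C, x * y = y * x) (hX : X ⊆ C) :
    IsClosedIdealOf C (Ann C X) where
  subset := fun x hx => hx.1
  zero_mem := ⟨hC.zero_mem, fun x _ => by simp⟩
  add_mem := fun x hx y hy => ⟨hC.add_mem x hx.1 y hy.1, fun z hz => by
    simp [add_mul, mul_add, hx.2 z hz, hy.2 z hz]⟩
  smul_mem := fun c x hx => ⟨hC.smul_mem c x hx.1, fun z hz => by
    simp [smul_mul_assoc, mul_smul_comm, hx.2 z hz]⟩
  mul_left := fun c hc x hx => ⟨hC.mul_mem c hc x hx.1, fun z hz => by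
    constructor
    · rw [mul_assoc, (hx.2 z hz).1, mul_zero]
    · rw [← mul_assoc, hab z (hX hz) c hc, mul_assoc, (hx.2 z hz).2, mul_zero]⟩
  mul_right := fun x hx c hc => ⟨hC.mul_mem x hx.1 c hc, fun z hz => by
    constructor
    · rw [mul_assoc, hab c hc z (hX hz), ← mul_assoc, (hx.2 z hz).1, zero_mul]
    · rw [← mul_assoc, (hx.2 z hz).2, zero_mul]⟩
  isClosed := by
    have h : Ann C X = C ∩ ⋂ z ∈ X, ({c : A | c * z = 0} ∩ {c : A | z * c = 0}) := by
      ext c; simp [Ann]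
    rw [h]
    refine hC.isClosed.inter (isClosed_biInter fun z _ => IsClosed.inter ?_ ?_)
    · exact isClosed_eq (by fun_prop) (by fun_prop)
    · exact isClosed_eq (by fun_prop) (by fun_prop)

/-- Let `(A,D)` be a pseudo-Cartan inclusion with Cartan envelope
`(A₁, D₁, α)` and let `J₁` be an invariant regular ideal of `D₁`.  Then `α⁻¹(J₁)`
(the preimage of `J₁` under `α` within `D`) is an invariant regular ideal of `D`. -/
theorem preimage_invariant_regular
    {A : Type*} [NonUnitalCStarAlgebra A] [PartialOrder A] [StarOrderedRing A]
    {A₁ : Type*} [NonUnitalCStarAlgebra A₁] [PartialOrder A₁] [StarOrderedRing A₁]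
    (D : Set A) (D₁ : Set A₁) (α : A →⋆ₙₐ[ℂ] A₁) (E : A₁ → A₁)
    (hD : IsPseudoCartan D) (henv : IsCartanEnvelope D D₁ α E)
    (J₁ : Set A₁) (hJ₁ : IsInvariantRegularIdeal D₁ J₁) :
    IsInvariantRegularIdeal D (D ∩ ⇑α ⁻¹' J₁) := by
  have hc := henv.cartan
  have hI₁ := hc.regularInclusion.1
  have hI := hD.inclusion
  obtain ⟨⟨hJ, hreg⟩, hinv⟩ := hJ₁
  have hα : Continuous α := map_continuous α
  refine ⟨⟨⟨Set.inter_subset_left, ⟨hI.zero_mem, ?_⟩, ?_, ?_, ?_, ?_, ?_⟩, ?_⟩, ?_⟩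
  · simpa using hJ.zero_mem
  · rintro x ⟨hx, hx'⟩ y ⟨hy, hy'⟩
    refine ⟨hI.add_mem x hx y hy, ?_⟩
    simpa using hJ.add_mem _ hx' _ hy'
  · rintro c x ⟨hx, hx'⟩
    refine ⟨hI.smul_mem c x hx, ?_⟩
    simpa using hJ.smul_mem c _ hx'
  · rintro c hc x ⟨hx, hx'⟩
    refine ⟨hI.mul_mem c hc x hx, ?_⟩
    simpa using hJ.mul_left _ (henv.maps c hc) _ hx'
  · rintro x ⟨hx, hx'⟩ c hc
    refine ⟨hI.mul_mem x hx c hc, ?_⟩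
    simpa using hJ.mul_right _ hx' _ (henv.maps c hc)
  · exact hI.isClosed.inter (hJ.isClosed.preimage hα)
  · apply Set.Subset.antisymm
    · rintro d ⟨hd, hd'⟩
      refine ⟨hd, ?_⟩
      have hαd := henv.maps d hd
      change α d ∈ J₁
      rw [← hreg]
      have key : ∀ c ∈ Ann D₁ J₁, α d * c = 0 := by
        intro c hcJ
        by_contra hne
        have hX : J₁ ∪ Ann D₁ {α d} ⊆ D₁ := Set.union_subset hJ.subset (fun x hx => hx.1)
        have hann := ann_closedIdeal D₁ _ hI₁ hc.abelian hX
        have hannJ := ann_closedIdeal D₁ J₁ hI₁ hc.abelian hJ.subset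
        have hmem : α d * c ∈ Ann D₁ (J₁ ∪ Ann D₁ {α d}) := by
          have h1 := hannJ.mul_left _ hαd c hcJ
          refine ⟨h1.1, ?_⟩
          rintro z (hz | hz)
          · exact h1.2 z hz
          · have h2 := (hz.2 (α d) rfl).1
            have h3 : z * (α d * c) = 0 := by rw [← mul_assoc, h2, zero_mul]
            exact ⟨by rw [hc.abelian _ h1.1 z hz.1, h3], h3⟩
        obtain ⟨y, ⟨hy, e, he, rfl⟩, hy0⟩ := henv.iip _ hann ⟨_, hmem, hne⟩
        have heK : e ∈ Ann D (D ∩ ⇑α ⁻¹' J₁) := by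
          refine ⟨he, fun x hx => ?_⟩
          have h := hy.2 (α x) (Or.inl hx.2)
          constructor
          · apply henv.injective; rw [map_mul, map_zero]; exact h.1
          · apply henv.injective; rw [map_mul, map_zero]; exact h.2
        have hde := hd' e heK
        have hin : α e ∈ Ann D₁ {α d} := by
          refine ⟨hy.1, ?_⟩
          rintro x rfl
          rw [← map_mul, ← map_mul, hde.1, hde.2, map_zero]
          exact ⟨rfl, rfl⟩
        have hs : star (α e) ∈ D₁ := hI₁.star_mem _ hy.1
        have hin2 := (ann_closedIdeal D₁ {α d} hI₁ hc.abelian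
          (by rintro x rfl; exact hαd)).mul_left _ hs _ hin
        have h0 := (hy.2 _ (Or.inr hin2)).1
        apply hy0
        have h1 : star (star (α e) * α e) * (star (α e) * α e) = 0 := by
          rw [star_mul, star_star, mul_assoc, h0, mul_zero]
        exact (CStarRing.star_mul_self_eq_zero_iff _).1 ((CStarRing.star_mul_self_eq_zero_iff _).1 h1)
      refine ⟨hαd, fun c hcJ => ⟨key c hcJ, ?_⟩⟩
      rw [hc.abelian c hcJ.1 _ hαd, key c hcJ]
    · intro x hx
      exact ⟨hx.1, fun y hy => ⟨(hy.2 x hx).2, (hy.2 x hx).1⟩⟩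
  · rintro n hn x ⟨hx, hx'⟩
    refine ⟨hn.1 x hx, ?_⟩
    have := hinv _ (henv.regular_morphism n hn) _ hx'
    simpa [map_mul, map_star] using this
end

section
/- Let (A,D) be a pseudo-Cartan inclusion with Cartan envelope (A₁, D₁, α). Then the map J ↦ α(J)^{⊥⊥_{D₁}} (double annihilator computed in D₁) is an inclusion-preserving bijection from the set of invariant regular ideals of D onto the set of invariant regular ideals of D₁, with inverse given by K ↦ α^{-1}(K). -/
section Helpers

variable {A : Type*} [NonUnitalCStarAlgebra A] [PartialOrder A] [StarOrderedRing A]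

theorem eq_zero_of_sq {D : Set A} (hD : IsInclusion D)
    (hab : ∀ x ∈ D, ∀ y ∈ D, x * y = y * x) {a : A} (ha : a ∈ D) (h : a * a = 0) : a = 0 := by
  have hc := hab _ (hD.star_mem a ha) a ha
  have : star (star a * a) * (star a * a) = 0 := by
    rw [star_mul, star_star]
    calc star a * a * (star a * a) = star a * (a * star a) * a := by simp only [mul_assoc]
      _ = star a * (star a * a) * a := by rw [hc]
      _ = star a * star a * (a * a) := by simp only [mul_assoc]
      _ = 0 := by rw [h, mul_zero]
  rw [CStarRing.star_mul_self_eq_zero_iff, CStarRing.star_mul_self_eq_zero_iff] at this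
  exact this

theorem ann_anti (C : Set A) {X Y : Set A} (h : X ⊆ Y) : Ann C Y ⊆ Ann C X :=
  fun _ hc => ⟨hc.1, fun x hx => hc.2 x (h hx)⟩

theorem subset_ann_ann {C X : Set A} (h : X ⊆ C) : X ⊆ Ann C (Ann C X) :=
  fun x hx => ⟨h hx, fun c hc => ⟨(hc.2 x hx).2, (hc.2 x hx).1⟩⟩

theorem ann_sub (C X : Set A) : Ann C X ⊆ C := fun _ h => h.1

theorem ann_ann_ann (C : Set A) {X : Set A} (h : X ⊆ C) :
    Ann C (Ann C (Ann C X)) = Ann C X :=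
  Set.Subset.antisymm (ann_anti C (subset_ann_ann h)) (subset_ann_ann (ann_sub C X))

theorem ann_isClosedIdeal {D : Set A} (hD : IsInclusion D)
    (hab : ∀ x ∈ D, ∀ y ∈ D, x * y = y * x) {X : Set A} (hX : X ⊆ D) :
    IsClosedIdealOf D (Ann D X) where
  subset := ann_sub D X
  zero_mem := ⟨hD.zero_mem, fun x _ => by simp⟩
  add_mem := fun x hx y hy => ⟨hD.add_mem x hx.1 y hy.1, fun z hz => by
    simp [add_mul, mul_add, hx.2 z hz, hy.2 z hz]⟩
  smul_mem := fun c x hx => ⟨hD.smul_mem c x hx.1, fun z hz => by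
    simp [smul_mul_assoc, mul_smul_comm, hx.2 z hz]⟩
  mul_left := fun c hc x hx => ⟨hD.mul_mem c hc x hx.1, fun z hz => by
    constructor
    · rw [mul_assoc, (hx.2 z hz).1, mul_zero]
    · rw [← mul_assoc, hab z (hX hz) c hc, mul_assoc, (hx.2 z hz).2, mul_zero]⟩
  mul_right := fun x hx c hc => ⟨hD.mul_mem x hx.1 c hc, fun z hz => by
    constructor
    · rw [mul_assoc, hab c hc z (hX hz), ← mul_assoc, (hx.2 z hz).1, zero_mul]
    · rw [← mul_assoc, (hx.2 z hz).2, zero_mul]⟩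
  isClosed := by
    have : Ann D X = D ∩ ⋂ x ∈ X, ({c | c * x = 0} ∩ {c | x * c = 0}) := by
      ext c; simp [Ann]
    rw [this]
    refine hD.isClosed.inter (isClosed_biInter fun x _ => IsClosed.inter ?_ ?_)
    · exact isClosed_eq (by fun_prop) continuous_const
    · exact isClosed_eq (by fun_prop) continuous_const

/-- If `n` normalizes `D`, `X` absorbs `n x x* n*`, and `y ∈ X^⊥` then `y n x = 0`. -/
theorem mul_mul_eq_zero {D X : Set A} {m x y : A}
    (h : m * (x * star x) * star m ∈ X) (hy : y ∈ Ann D X) : y * m * x = 0 := by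
  rw [← CStarRing.mul_star_self_eq_zero_iff]
  calc y * m * x * star (y * m * x) = y * (m * (x * star x) * star m) * star y := by
        simp only [star_mul, mul_assoc]
    _ = 0 := by rw [(hy.2 _ h).1, zero_mul]

theorem isNormalizer_star_s10 {D : Set A} {n : A} (h : IsNormalizer D n) :
    IsNormalizer D (star n) := ⟨by simpa using h.2, by simpa using h.1⟩

/-- Normalizers of `D` that, together with their adjoints, leave `K` invariant. -/
def KNorm (D K : Set A) : Set A :=
  {m | IsNormalizer D m ∧ (∀ x ∈ K, m * x * star m ∈ K) ∧ (∀ x ∈ K, star m * x * m ∈ K)}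

theorem KNorm_mul {D K : Set A} {m n : A} (hm : m ∈ KNorm D K) (hn : n ∈ KNorm D K) :
    m * n ∈ KNorm D K := by
  have e1 : ∀ x, m * n * x * star (m * n) = m * (n * x * star n) * star m := fun x => by
    simp only [star_mul, mul_assoc]
  have e2 : ∀ x, star (m * n) * x * (m * n) = star n * (star m * x * m) * n := fun x => by
    simp only [star_mul, mul_assoc]
  refine ⟨⟨fun b hb => ?_, fun b hb => ?_⟩, fun b hb => ?_, fun b hb => ?_⟩
  · rw [e1]; exact hm.1.1 _ (hn.1.1 _ hb)
  · rw [e2]; exact hn.1.2 _ (hm.1.2 _ hb)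
  · rw [e1]; exact hm.2.1 _ (hn.2.1 _ hb)
  · rw [e2]; exact hn.2.2 _ (hm.2.2 _ hb)

theorem KNorm_star {D K : Set A} {m : A} (hm : m ∈ KNorm D K) : star m ∈ KNorm D K :=
  ⟨isNormalizer_star_s10 hm.1, by simpa using hm.2.2, by simpa using hm.2.1⟩

theorem span_star {T : Set A} (hs : ∀ a ∈ T, star a ∈ T) {a : A}
    (ha : a ∈ Submodule.span ℂ T) : star a ∈ Submodule.span ℂ T := by
  induction ha using Submodule.span_induction with
  | mem x hx => exact Submodule.subset_span (hs x hx)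
  | zero => simp
  | add x y _ _ hx hy => rw [star_add]; exact add_mem hx hy
  | smul c x _ hx => rw [star_smul]; exact Submodule.smul_mem _ _ hx

theorem span_mul' {T : Set A} (hm : ∀ a ∈ T, ∀ b ∈ T, a * b ∈ T) {a b : A}
    (ha : a ∈ Submodule.span ℂ T) (hb : b ∈ Submodule.span ℂ T) :
    a * b ∈ Submodule.span ℂ T := by
  induction ha using Submodule.span_induction with
  | mem x hx =>
    induction hb using Submodule.span_induction with
    | mem y hy => exact Submodule.subset_span (hm x hx y hy)
    | zero => simp
    | add y z _ _ hy hz => rw [mul_add]; exact add_mem hy hz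
    | smul c y _ hy => rw [mul_smul_comm]; exact Submodule.smul_mem _ _ hy
  | zero => simp
  | add x y _ _ hx hy => rw [add_mul]; exact add_mem hx hy
  | smul c x _ hx => rw [smul_mul_assoc]; exact Submodule.smul_mem _ _ hx

theorem generated_subset {S T : Set A} (hm : ∀ a ∈ T, ∀ b ∈ T, a * b ∈ T)
    (hs : ∀ a ∈ T, star a ∈ T)
    (hST : S ⊆ closure (Submodule.span ℂ T : Set A)) :
    GeneratedCStar S ⊆ closure (Submodule.span ℂ T : Set A) := by
  refine closure_minimal ?_ isClosed_closure
  intro a ha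
  have ha' : a ∈ NonUnitalStarAlgebra.adjoin ℂ S := ha
  change a ∈ (Submodule.span ℂ T).topologicalClosure
  induction ha' using NonUnitalStarAlgebra.adjoin_induction with
  | mem x hx => exact hST hx
  | add x y hx' hy' hx hy => exact add_mem (hx hx') (hy hy')
  | zero => exact zero_mem _
  | mul x y hx' hy' hx hy =>
    exact map_mem_closure₂ continuous_mul (hx hx') (hy hy') fun a ha b hb => span_mul' hm ha hb
  | smul c x hx' hx => exact Submodule.smul_mem _ _ (hx hx')
  | star x hx' hx =>
    exact map_mem_closure continuous_star (hx hx') fun a ha => span_star hs ha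

end Helpers

section Main

variable {A : Type*} [NonUnitalCStarAlgebra A] [PartialOrder A] [StarOrderedRing A]
variable {A₁ : Type*} [NonUnitalCStarAlgebra A₁] [PartialOrder A₁] [StarOrderedRing A₁]
variable {D : Set A} {D₁ : Set A₁} {α : A →⋆ₙₐ[ℂ] A₁} {E : A₁ → A₁}

theorem alpha_continuous (α : A →⋆ₙₐ[ℂ] A₁) : Continuous α :=
  AddMonoidHomClass.continuous_of_bound α 1 fun x => by
    simpa using NonUnitalStarAlgHom.norm_apply_le α x

theorem image_sub (henv : IsCartanEnvelope D D₁ α E) {J : Set A} (hJ : J ⊆ D) :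
    ⇑α '' J ⊆ D₁ := by
  rintro _ ⟨j, hj, rfl⟩
  exact henv.maps j (hJ hj)

theorem alpha_mem_ann (henv : IsCartanEnvelope D D₁ α E) {J : Set A} {c : A} :
    c ∈ Ann D J → α c ∈ Ann D₁ (⇑α '' J) := by
  rintro ⟨hc, h⟩
  refine ⟨henv.maps c hc, ?_⟩
  rintro _ ⟨j, hj, rfl⟩
  rw [← map_mul, ← map_mul, (h j hj).1, (h j hj).2, map_zero]
  exact ⟨rfl, rfl⟩

theorem mem_ann_of_alpha (henv : IsCartanEnvelope D D₁ α E) {J : Set A} {c : A} (hc : c ∈ D)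
    (h : α c ∈ Ann D₁ (⇑α '' J)) : c ∈ Ann D J := by
  refine ⟨hc, fun j hj => ?_⟩
  have := h.2 (α j) ⟨j, hj, rfl⟩
  rw [← map_mul, ← map_mul] at this
  exact ⟨henv.injective (by simpa using this.1), henv.injective (by simpa using this.2)⟩

theorem ann_trivial (henv : IsCartanEnvelope D D₁ α E) {X : Set A₁} (hX : X ⊆ D₁)
    (h : ∀ d ∈ D, α d ∈ Ann D₁ X → α d = 0) {z : A₁} (hz : z ∈ Ann D₁ X) : z = 0 := by
  by_contra hne
  obtain ⟨_, ⟨hx, ⟨d, hd, rfl⟩⟩, hx0⟩ := henv.iip (Ann D₁ X)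
    (ann_isClosedIdeal henv.cartan.regularInclusion.1 henv.cartan.abelian hX) ⟨z, hz, hne⟩
  exact hx0 (h d hd hx)

theorem comap_map (henv : IsCartanEnvelope D D₁ α E) {J : Set A} (hJ : IsRegularIdealOf D J) :
    D ∩ ⇑α ⁻¹' (Ann D₁ (Ann D₁ (⇑α '' J))) = J := by
  apply Set.Subset.antisymm
  · rintro d ⟨hd, h⟩
    rw [← hJ.2]
    refine mem_ann_of_alpha henv hd (ann_anti D₁ ?_ h)
    rintro _ ⟨c, hc, rfl⟩
    exact alpha_mem_ann henv hc
  · intro j hj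
    exact ⟨hJ.1.subset hj, subset_ann_ann (image_sub henv hJ.1.subset) ⟨j, hj, rfl⟩⟩

theorem map_comap (henv : IsCartanEnvelope D D₁ α E) {K : Set A₁} (hK : IsRegularIdealOf D₁ K) :
    Ann D₁ (Ann D₁ (⇑α '' (D ∩ ⇑α ⁻¹' K))) = K := by
  have hI := henv.cartan.regularInclusion.1
  have hab := henv.cartan.abelian
  have hsub : ⇑α '' (D ∩ ⇑α ⁻¹' K) ⊆ K := by
    rintro _ ⟨j, hj, rfl⟩
    exact hj.2
  apply Set.Subset.antisymm
  · conv_rhs => rw [← hK.2]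
    exact ann_anti _ (ann_anti _ hsub)
  · intro x hx
    have hxD := hK.1.subset hx
    refine ⟨hxD, fun y hy => ?_⟩
    have key : x * y = 0 := by
      refine ann_trivial (X := Ann D₁ K ∪ ⇑α '' (D ∩ ⇑α ⁻¹' K)) henv
        (Set.union_subset (ann_sub _ _) (hsub.trans hK.1.subset)) ?_ ?_
      · intro d hd h
        have h1 : α d ∈ K := by
          rw [← hK.2]
          exact ann_anti _ Set.subset_union_left h
        exact eq_zero_of_sq hI hab (henv.maps d hd)
          (h.2 _ (Set.mem_union_right _ ⟨d, ⟨hd, h1⟩, rfl⟩)).1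
      · have h1 : x * y ∈ Ann D₁ (Ann D₁ K) := by
          rw [hK.2]
          exact hK.1.mul_right x hx y hy.1
        have h2 := (ann_isClosedIdeal hI hab (hsub.trans hK.1.subset)).mul_left x hxD y hy
        refine ⟨h1.1, ?_⟩
        rintro z (hz | hz)
        · exact h1.2 z hz
        · exact h2.2 z hz
    exact ⟨key, by rw [hab y hy.1 x hxD, key]⟩

theorem comap_invReg (hD : IsPseudoCartan D) (henv : IsCartanEnvelope D D₁ α E) {K : Set A₁}
    (hK : IsInvariantRegularIdeal D₁ K) : IsInvariantRegularIdeal D (D ∩ ⇑α ⁻¹' K) := by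
  have hI := henv.cartan.regularInclusion.1
  have hab := henv.cartan.abelian
  have hID := hD.inclusion
  have hKc := hK.1.1
  refine ⟨⟨⟨Set.inter_subset_left, ⟨hID.zero_mem, ?_⟩, ?_, ?_, ?_, ?_, ?_⟩, ?_⟩, ?_⟩
  · simpa using hKc.zero_mem
  · intro x hx y hy
    refine ⟨hID.add_mem x hx.1 y hy.1, ?_⟩
    simpa using hKc.add_mem _ hx.2 _ hy.2
  · intro c x hx
    refine ⟨hID.smul_mem c x hx.1, ?_⟩
    simpa using hKc.smul_mem c _ hx.2
  · intro c hc x hx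
    refine ⟨hID.mul_mem c hc x hx.1, ?_⟩
    simpa using hKc.mul_left _ (henv.maps c hc) _ hx.2
  · intro x hx c hc
    refine ⟨hID.mul_mem x hx.1 c hc, ?_⟩
    simpa using hKc.mul_right _ hx.2 _ (henv.maps c hc)
  · exact hID.isClosed.inter (hKc.isClosed.preimage (alpha_continuous α))
  · refine Set.Subset.antisymm ?_ (subset_ann_ann Set.inter_subset_left)
    intro d hd
    refine ⟨hd.1, ?_⟩
    change α d ∈ K
    rw [← map_comap henv hK.1]
    set J := D ∩ ⇑α ⁻¹' K with hJ
    have hJD : J ⊆ D := Set.inter_subset_left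
    have hdD := henv.maps d hd.1
    have s1 := image_sub henv hJD
    have s2 := image_sub henv (ann_sub D J)
    refine ⟨hdD, fun y hy => ?_⟩
    have key : α d * y = 0 := by
      refine ann_trivial (X := ⇑α '' J ∪ ⇑α '' (Ann D J)) henv (Set.union_subset s1 s2) ?_ ?_
      · intro c hc h
        have h1 : c ∈ Ann D J :=
          mem_ann_of_alpha henv hc (ann_anti _ Set.subset_union_left h)
        exact eq_zero_of_sq hI hab (henv.maps c hc)
          (h.2 _ (Set.mem_union_right _ ⟨c, h1, rfl⟩)).1
      · have h1 := (ann_isClosedIdeal hI hab s1).mul_left _ hdD y hy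
        have h2 := (ann_isClosedIdeal hI hab s2).mul_right _ (alpha_mem_ann henv hd) y hy.1
        refine ⟨h1.1, ?_⟩
        rintro z (hz | hz)
        · exact h1.2 z hz
        · exact h2.2 z hz
    exact ⟨key, by rw [hab y hy.1 _ hdD, key]⟩
  · intro n hn x hx
    refine ⟨hn.1 x hx.1, ?_⟩
    have := hK.2 (α n) (henv.regular_morphism n hn) _ hx.2
    simpa [map_star] using this

theorem alpha_n_inv (hD : IsPseudoCartan D) (henv : IsCartanEnvelope D D₁ α E) {J : Set A}
    (hJ : IsInvariantRegularIdeal D J) {n : A} (hn : IsNormalizer D n) :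
    ∀ x ∈ Ann D₁ (Ann D₁ (⇑α '' J)), α n * x * star (α n) ∈ Ann D₁ (Ann D₁ (⇑α '' J)) := by
  have hI := henv.cartan.regularInclusion.1
  have hab := henv.cartan.abelian
  have hαn := henv.regular_morphism n hn
  intro x hx
  have hmem := hαn.1 x hx.1
  refine ⟨hmem, fun y hy => ?_⟩
  -- `n* (y* y) n` annihilates `α(J)`
  have hyy : star y * y ∈ Ann D₁ (⇑α '' J) :=
    (ann_isClosedIdeal hI hab (image_sub henv hJ.1.1.subset)).mul_left _
      (hI.star_mem y hy.1) y hy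
  have h1 : star (α n) * (star y * y) * α n ∈ Ann D₁ (⇑α '' J) := by
    have hm := hαn.2 _ hyy.1
    refine ⟨hm, ?_⟩
    rintro _ ⟨j, hj, rfl⟩
    have e : star y * y * α n * α j = 0 := by
      refine mul_mul_eq_zero (D := D₁) (X := ⇑α '' J) ?_ hyy
      refine ⟨n * (j * star j) * star n, ?_, by simp [map_star]⟩
      exact hJ.2 n hn _ (hJ.1.1.mul_right j hj _ (hD.inclusion.star_mem j (hJ.1.1.subset hj)))
    have e' : star (α n) * (star y * y) * α n * α j = 0 := by
      calc _ = star (α n) * (star y * y * α n * α j) := by simp only [mul_assoc]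
        _ = 0 := by rw [e, mul_zero]
    exact ⟨e', by rw [hab _ (henv.maps j (hJ.1.1.subset hj)) _ hm, e']⟩
  have h2 : y * α n * x = 0 := by
    rw [← CStarRing.star_mul_self_eq_zero_iff]
    calc star (y * α n * x) * (y * α n * x)
        = star x * ((star (α n) * (star y * y) * α n) * x) := by
          simp only [star_mul, mul_assoc]
      _ = 0 := by rw [(hx.2 _ h1).2, mul_zero]
  have h3 : y * (α n * x * star (α n)) = 0 := by
    rw [← mul_assoc, ← mul_assoc, h2, zero_mul]
  exact ⟨by rw [hab _ hmem y hy.1, h3], h3⟩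

theorem map_invReg (hD : IsPseudoCartan D) (henv : IsCartanEnvelope D D₁ α E) {J : Set A}
    (hJ : IsInvariantRegularIdeal D J) :
    IsInvariantRegularIdeal D₁ (Ann D₁ (Ann D₁ (⇑α '' J))) := by
  have hI := henv.cartan.regularInclusion.1
  have hab := henv.cartan.abelian
  have hinv := fun n hn => alpha_n_inv hD henv hJ (n := n) hn
  have hKc := ann_isClosedIdeal hI hab (ann_sub D₁ (⇑α '' J))
  have hKr := ann_ann_ann D₁ (ann_sub D₁ (⇑α '' J))
  set K := Ann D₁ (Ann D₁ (⇑α '' J)) with hKdef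
  refine ⟨⟨hKc, hKr⟩, ?_⟩
  -- normalizers leaving `K` invariant span a dense subspace
  have hdense : ∀ a : A₁, a ∈ closure (Submodule.span ℂ (KNorm D₁ K) : Set A₁) := by
    have hsub : Set.range ⇑α ∪ E '' Set.range ⇑α ⊆
        closure (Submodule.span ℂ (KNorm D₁ K) : Set A₁) := by
      rintro _ (⟨a, rfl⟩ | ⟨b, -, rfl⟩)
      · refine map_mem_closure (alpha_continuous α) (hD.regular a) fun b hb => ?_
        have hb' : b ∈ Submodule.span ℂ {n : A | IsNormalizer D n} := hb
        change α b ∈ Submodule.span ℂ (KNorm D₁ K)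
        induction hb' using Submodule.span_induction with
        | mem n hn =>
          refine Submodule.subset_span ⟨henv.regular_morphism n hn, hinv n hn, ?_⟩
          simpa [map_star] using hinv (star n) (isNormalizer_star_s10 hn)
        | zero => simp
        | add x y hx' hy' hx hy => rw [map_add]; exact add_mem (hx hx') (hy hy')
        | smul c x hx' hx => rw [map_smul]; exact Submodule.smul_mem _ _ (hx hx')
      · have hd := henv.cartan.condExp.mem b
        have hds := hI.star_mem _ hd
        refine subset_closure (Submodule.subset_span ⟨⟨?_, ?_⟩, ?_, ?_⟩)
        · exact fun x hx => hI.mul_mem _ (hI.mul_mem _ hd _ hx) _ hds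
        · exact fun x hx => hI.mul_mem _ (hI.mul_mem _ hds _ hx) _ hd
        · exact fun x hx => hKc.mul_right _ (hKc.mul_left _ hd _ hx) _ hds
        · exact fun x hx => hKc.mul_right _ (hKc.mul_left _ hds _ hx) _ hd
    intro a
    refine generated_subset (fun a ha b hb => KNorm_mul ha hb) (fun a ha => KNorm_star ha) hsub ?_
    rw [henv.generates]
    trivial
  have hzero : ∀ x ∈ K, ∀ y ∈ Ann D₁ K, ∀ a : A₁, y * a * x = 0 := by
    intro x hx y hy a
    have hcl : IsClosed {a : A₁ | y * a * x = 0} :=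
      isClosed_eq (by fun_prop) continuous_const
    refine closure_minimal ?_ hcl (hdense a)
    intro b hb
    have hb' : b ∈ Submodule.span ℂ (KNorm D₁ K) := hb
    change y * b * x = 0
    clear hb
    induction hb' using Submodule.span_induction with
    | mem m hm =>
      exact mul_mul_eq_zero (hm.2.1 _ (hKc.mul_right _ hx _ (hI.star_mem x hx.1))) hy
    | zero => simp
    | add u v _ _ hu hv => rw [mul_add, add_mul, hu, hv, add_zero]
    | smul c u _ hu => rw [mul_smul_comm, smul_mul_assoc, hu, smul_zero]
  intro v hv x hx
  rw [← hKr]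
  have hmem := hv.1 x (hKc.subset hx)
  refine ⟨hmem, fun y hy => ?_⟩
  have h3 : y * (v * x * star v) = 0 := by
    rw [← mul_assoc, ← mul_assoc, hzero x hx y hy v, zero_mul]
  exact ⟨by rw [hab _ hmem y hy.1, h3], h3⟩

end Main

/-- Let `(A,D)` be a pseudo-Cartan inclusion with Cartan envelope
`(A₁, D₁, α)`.  Then `J ↦ α(J)^{⊥⊥_{D₁}}` is an inclusion-preserving bijection from the
invariant regular ideals of `D` onto the invariant regular ideals of `D₁`, with inverse
`K ↦ α⁻¹(K)`. -/
theorem invariant_regular_ideal_lattice_iso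
    {A : Type*} [NonUnitalCStarAlgebra A] [PartialOrder A] [StarOrderedRing A]
    {A₁ : Type*} [NonUnitalCStarAlgebra A₁] [PartialOrder A₁] [StarOrderedRing A₁]
    (D : Set A) (D₁ : Set A₁) (α : A →⋆ₙₐ[ℂ] A₁) (E : A₁ → A₁)
    (hD : IsPseudoCartan D) (henv : IsCartanEnvelope D D₁ α E) :
    Set.BijOn (fun J => Ann D₁ (Ann D₁ (⇑α '' J)))
      {J : Set A | IsInvariantRegularIdeal D J}
      {K : Set A₁ | IsInvariantRegularIdeal D₁ K} ∧
    (∀ J : Set A, IsInvariantRegularIdeal D J →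
      D ∩ ⇑α ⁻¹' (Ann D₁ (Ann D₁ (⇑α '' J))) = J) ∧
    (∀ K : Set A₁, IsInvariantRegularIdeal D₁ K →
      Ann D₁ (Ann D₁ (⇑α '' (D ∩ ⇑α ⁻¹' K))) = K) ∧
    (∀ J J' : Set A, IsInvariantRegularIdeal D J → IsInvariantRegularIdeal D J' →
      J ⊆ J' → Ann D₁ (Ann D₁ (⇑α '' J)) ⊆ Ann D₁ (Ann D₁ (⇑α '' J'))) := by
  refine ⟨⟨fun J hJ => map_invReg hD henv hJ, ?_, ?_⟩, fun J hJ => comap_map henv hJ.1,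
    fun K hK => map_comap henv hK.1, fun J J' _ _ h => ?_⟩
  · intro J hJ J' hJ' h
    rw [← comap_map henv hJ.1, ← comap_map henv hJ'.1]
    exact congrArg (fun K => D ∩ ⇑α ⁻¹' K) h
  · intro K hK
    exact ⟨_, comap_invReg hD henv hK, map_comap henv hK.1⟩
  · exact ann_anti _ (ann_anti _ (Set.image_mono h))
end
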